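/- For every ε > 0 there exist δ = δ(ε) > 0 and p_0 such that for every prime p ≥ p_0, all intervals I_1, I_2 ⊂ F_p not containing 0 with |I_1| > p^{1/18} and |I_2| > p^{5/12+ε}, all complex coefficients α_1(x_1), α_2(x_2) with |α_1(x_1)| ≤ 1 and |α_2(x_2)| ≤ 1, and every a ∈ F_p with a ≠ 0, one has |∑_{x_1∈I_1} ∑_{x_2∈I_2} α_1(x_1) α_2(x_2) e_p(a x_1^{-1} x_2^{-1})| < p^{−δ}·|I_1|·|I_2|. -/

import Mathlib

open Finset

/-- The interval `{a+1, a+2, …, a+N}` in `ZMod p`. -/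
def interval (p : ℕ) (a : ZMod p) (N : ℕ) : Finset (ZMod p) :=
  (Finset.Icc 1 N).image (fun i : ℕ => a + (i : ZMod p))

/-- `e_p(z) = exp(2πi z/p)` for `z ∈ ZMod p`. -/
noncomputable def ep (p : ℕ) (z : ZMod p) : ℂ :=
  Complex.exp (2 * (Real.pi : ℂ) * Complex.I * (z.val : ℂ) / (p : ℂ))

/-- The divisor bound `τ(n) ≪ n^η`. -/
theorem exists_card_divisors_le_rpow (η : ℝ) (hη : 0 < η) :
    ∃ C : ℝ, 1 ≤ C ∧ ∀ n : ℕ, n ≠ 0 → (#n.divisors : ℝ) ≤ C * (n : ℝ) ^ η := by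
  obtain ⟨K, hK⟩ : ∃ K : ℕ, ∀ q : ℕ, K ≤ q → (2 : ℝ) ≤ (q : ℝ) ^ η :=
    Filter.eventually_atTop.1
      (((tendsto_rpow_atTop hη).comp tendsto_natCast_atTop_atTop).eventually_ge_atTop 2)
  set B : ℝ := max 1 (2 / η) with hB
  have hB1 : 1 ≤ B := le_max_left _ _
  have key : ∀ q : ℕ, q.Prime → ∀ e : ℕ,
      (e + 1 : ℝ) ≤ (if q < K then B else 1) * ((q : ℝ) ^ e) ^ η := by
    intro q hq e
    have hq2 : (2 : ℝ) ≤ q := by exact_mod_cast hq.two_le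
    have hcomm : ((q : ℝ) ^ e) ^ η = ((q : ℝ) ^ η) ^ e := by
      rw [← Real.rpow_natCast, ← Real.rpow_mul (by positivity), mul_comm,
        Real.rpow_mul (by positivity), Real.rpow_natCast]
    split_ifs with h
    · have h1 : 1 + e * (η / 2) ≤ ((q : ℝ) ^ e) ^ η := by
        have h2 : 1 + η / 2 ≤ (q : ℝ) ^ η := by
          calc 1 + η / 2 ≤ 1 + η * Real.log 2 := by
                have := Real.log_two_gt_d9
                nlinarith
            _ ≤ Real.exp (η * Real.log 2) := by
                have := Real.add_one_le_exp (η * Real.log 2)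
                linarith
            _ = 2 ^ η := by rw [Real.rpow_def_of_pos (by norm_num), mul_comm]
            _ ≤ (q : ℝ) ^ η := Real.rpow_le_rpow (by norm_num) hq2 hη.le
        rw [hcomm]
        calc 1 + e * (η / 2) ≤ (1 + η / 2) ^ e := one_add_mul_le_pow (by linarith) e
          _ ≤ _ := pow_le_pow_left₀ (by positivity) h2 e
      have h3 : (e : ℝ) ≤ B * (e * (η / 2)) := by
        have : 2 / η * (e * (η / 2)) = e := by field_simp
        calc (e : ℝ) = 2 / η * (e * (η / 2)) := this.symm
          _ ≤ _ := by gcongr; exact le_max_right _ _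
      nlinarith
    · rw [one_mul, hcomm]
      calc (e + 1 : ℝ) = 1 + e * 1 := by ring
        _ ≤ (1 + 1) ^ e := one_add_mul_le_pow (by norm_num) e
        _ ≤ _ := pow_le_pow_left₀ (by norm_num) (by linarith [hK q (not_lt.1 h)]) e
  refine ⟨B ^ K, one_le_pow₀ hB1, fun n hn ↦ ?_⟩
  have hn' : (n : ℝ) ^ η = ∏ q ∈ n.primeFactors, ((q : ℝ) ^ n.factorization q) ^ η := by
    rw [Real.finsetProd_rpow _ _ (fun _ _ ↦ by positivity)]
    congr 1
    conv_lhs => rw [← Nat.prod_factorization_pow_eq_self hn]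
    simp [Finsupp.prod]
  rw [Nat.card_divisors hn, hn']
  push_cast
  calc ∏ q ∈ n.primeFactors, ((n.factorization q : ℝ) + 1)
      ≤ ∏ q ∈ n.primeFactors, ((if q < K then B else 1) * ((q : ℝ) ^ n.factorization q) ^ η) :=
        prod_le_prod (fun _ _ ↦ by positivity)
          (fun q hq ↦ key q (Nat.prime_of_mem_primeFactors hq) _)
    _ = (∏ q ∈ n.primeFactors, if q < K then B else 1) *
        ∏ q ∈ n.primeFactors, ((q : ℝ) ^ n.factorization q) ^ η := prod_mul_distrib
    _ ≤ _ := by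
        gcongr
        rw [prod_ite, prod_const, prod_const_one, mul_one]
        refine pow_le_pow_right₀ hB1 ?_
        calc _ ≤ #(range K) := card_le_card fun q hq ↦ by simp_all
          _ = K := card_range K

/-- A set `U ⊆ [0, N)` such that no element of `a + U` vanishes and no two elements of `a + U`
(equal or not) add up to zero modulo `p`, where `N` is slightly smaller than `p ^ (1 / 18)`. -/
structure IsBlock (p : ℕ) (a : ZMod p) (N : ℕ) (U : Finset ℕ) : Prop where
  lt : ∀ u ∈ U, u < N
  ne_zero : ∀ u ∈ U, a + (u : ZMod p) ≠ 0
  add_ne_zero : ∀ u ∈ U, ∀ v ∈ U, (a + (u : ZMod p)) + (a + (v : ZMod p)) ≠ 0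
  small : 10 ^ 7 * N ^ 18 < p

theorem abs_mul_le_pow {x y α β n : ℤ} {i j : ℕ} (hx : |x| ≤ α * n ^ i) (hy : |y| ≤ β * n ^ j) :
    |x * y| ≤ α * β * n ^ (i + j) := by
  rw [abs_mul]
  calc |x| * |y| ≤ (α * n ^ i) * (β * n ^ j) :=
        mul_le_mul hx hy (abs_nonneg _) ((abs_nonneg _).trans hx)
    _ = _ := by ring

theorem abs_add_le_pow {x y α β n : ℤ} {i : ℕ} (hx : |x| ≤ α * n ^ i) (hy : |y| ≤ β * n ^ i) :
    |x + y| ≤ (α + β) * n ^ i := by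
  linarith [abs_add_le x y]

theorem abs_sub_le_pow {x y α β n : ℤ} {i : ℕ} (hx : |x| ≤ α * n ^ i) (hy : |y| ≤ β * n ^ i) :
    |x - y| ≤ (α + β) * n ^ i := by
  linarith [abs_sub x y]

theorem abs_sub_le_of_mem_Icc {x y b : ℤ} (hx : 0 ≤ x) (hx' : x ≤ b) (hy : 0 ≤ y) (hy' : y ≤ b) :
    |x - y| ≤ b := by
  rw [abs_le]; constructor <;> linarith

theorem eq_zero_of_intCast_eq_zero {p : ℕ} {x : ℤ} (hx : (x : ZMod p) = 0) (h : |x| < p) :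
    x = 0 :=
  Int.eq_zero_of_abs_lt_dvd ((ZMod.intCast_zmod_eq_zero_iff_dvd x p).1 hx) h

/-- A nonzero integer `G` has at most `2 τ(|G|)` integer divisors. -/
theorem card_le_of_forall_dvd {T : Finset ℤ} {G : ℤ} (hG : G ≠ 0) (hT : ∀ t ∈ T, t ∣ G) :
    #T ≤ 2 * #(G.natAbs.divisors) := by
  have : T ⊆ G.natAbs.divisors.image (fun n : ℕ ↦ (n : ℤ)) ∪
      G.natAbs.divisors.image (fun n : ℕ ↦ -(n : ℤ)) := by
    intro t ht
    have h1 : t.natAbs ∈ G.natAbs.divisors :=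
      Nat.mem_divisors.2 ⟨Int.natAbs_dvd_natAbs.2 (hT t ht), by simpa using hG⟩
    rw [mem_union, mem_image, mem_image]
    rcases Int.natAbs_eq t with h | h
    · exact Or.inl ⟨_, h1, h.symm⟩
    · exact Or.inr ⟨_, h1, h.symm⟩
  calc #T ≤ _ := card_le_card this
    _ ≤ _ := card_union_le _ _
    _ ≤ _ := by rw [two_mul]; exact add_le_add card_image_le card_image_le

namespace IsBlock

theorem mul_pow_lt {p : ℕ} {a : ZMod p} {N : ℕ} {U : Finset ℕ}
    (h : IsBlock p a N U) {u : ℕ} (hu : u ∈ U) {c : ℤ} {i : ℕ} (hc : c ≤ 10 ^ 7)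
    (hi : i ≤ 18) : c * (N : ℤ) ^ i < p := by
  have hN : 1 ≤ N := (Nat.zero_le u).trans_lt (h.lt u hu)
  calc c * (N : ℤ) ^ i ≤ 10 ^ 7 * (N : ℤ) ^ i := by gcongr
    _ ≤ 10 ^ 7 * (N : ℤ) ^ 18 := by gcongr; exact_mod_cast hN
    _ < p := by exact_mod_cast h.small

variable {p : ℕ} [Fact p.Prime] {a : ZMod p} {N : ℕ} {U : Finset ℕ}

theorem cast_inj (h : IsBlock p a N U) {u v : ℕ} (hu : u ∈ U) (hv : v ∈ U)
    (huv : (u : ZMod p) = v) : u = v := by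
  have h1 : ((u - v : ℤ) : ZMod p) = 0 := by push_cast; rw [huv, sub_self]
  have := h.lt u hu
  have := h.lt v hv
  have h2 := h.mul_pow_lt hu (c := 1) (i := 1) (by norm_num) (by norm_num)
  have := eq_zero_of_intCast_eq_zero h1 (by rw [abs_lt]; constructor <;> linarith)
  omega

theorem inv_inj (h : IsBlock p a N U) {u v : ℕ} (hu : u ∈ U) (hv : v ∈ U)
    (huv : (a + u)⁻¹ = (a + (v : ZMod p))⁻¹) : u = v :=
  h.cast_inj hu hv (by simpa using inv_injective huv)

/-- The number of representations of `μ` as a sum of two reciprocals is at most a multiple of a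
divisor function. -/
theorem card_two_le (h : IsBlock p a N U) {D : ℕ}
    (hD : ∀ n : ℕ, n ≠ 0 → n ≤ p ^ 3 → #n.divisors ≤ D) (μ : ZMod p) :
    #{s ∈ U ×ˢ U | (a + (s.1 : ZMod p))⁻¹ + (a + (s.2 : ZMod p))⁻¹ = μ} ≤ 6 * D := by
  set S := {s ∈ U ×ˢ U | (a + (s.1 : ZMod p))⁻¹ + (a + (s.2 : ZMod p))⁻¹ = μ} with hS
  have hmem : ∀ s ∈ S, s.1 ∈ U ∧ s.2 ∈ U ∧
      (a + (s.1 : ZMod p))⁻¹ + (a + (s.2 : ZMod p))⁻¹ = μ := by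
    intro s hs
    simpa [hS, and_assoc] using hs
  have hD1 : 1 ≤ D := by
    simpa using hD 1 one_ne_zero (Nat.one_le_pow _ _ (Fact.out : p.Prime).pos)
  have hinj : Set.InjOn Prod.fst (S : Set (ℕ × ℕ)) := by
    intro s hs t ht hst
    obtain ⟨-, h2, h3⟩ := hmem s hs
    obtain ⟨-, h5, h6⟩ := hmem t ht
    have hst' : s.1 = t.1 := hst
    rw [← h6, hst'] at h3
    exact Prod.ext hst' (h.inv_inj h2 h5 (add_left_cancel h3))
  have hsnd : ∀ s ∈ S, ∀ t ∈ S, s.2 = t.2 → s = t := by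
    intro s hs t ht hst
    obtain ⟨h1, -, h3⟩ := hmem s hs
    obtain ⟨h4, -, h6⟩ := hmem t ht
    rw [← h6, hst] at h3
    exact Prod.ext (h.inv_inj h1 h4 (add_right_cancel h3)) hst
  have hcross : ∀ s ∈ S, ∀ t ∈ S, s.1 = t.2 → s.2 = t.1 := by
    intro s hs t ht hst
    obtain ⟨h1, h2, h3⟩ := hmem s hs
    obtain ⟨h4, -, h6⟩ := hmem t ht
    rw [← h6, hst, add_comm] at h3
    exact h.inv_inj h2 h4 (add_right_cancel h3)
  rcases S.eq_empty_or_nonempty with hemp | ⟨s₁, hs₁⟩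
  · simp [hemp]
  obtain ⟨hu1, hv1, he1⟩ := hmem s₁ hs₁
  by_cases hall : ∀ s ∈ S, s.1 = s₁.1 ∨ s.1 = s₁.2
  · calc #S = #(S.image Prod.fst) := (card_image_of_injOn hinj).symm
      _ ≤ #{s₁.1, s₁.2} := card_le_card fun u hu ↦ by
          obtain ⟨s, hs, rfl⟩ := mem_image.1 hu
          simpa using hall s hs
      _ ≤ 2 := card_le_two
      _ ≤ 6 * D := by omega
  push Not at hall
  obtain ⟨s₂, hs₂, hne1, hne2⟩ := hall
  obtain ⟨hu2, hv2, he2⟩ := hmem s₂ hs₂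
  have lin : ∀ s ∈ S, (2 * a - μ * a ^ 2) + (1 - μ * a) * (s.1 + s.2) + (-μ) * (s.1 * s.2) = 0 := by
    intro s hs
    obtain ⟨h1, h2, h3⟩ := hmem s hs
    have h4 := h.ne_zero _ h1
    have h5 := h.ne_zero _ h2
    field_simp at h3
    linear_combination h3
  have bd : ∀ s ∈ S, (0 : ℤ) ≤ s.1 ∧ (s.1 : ℤ) ≤ N ∧ (0 : ℤ) ≤ s.2 ∧ (s.2 : ℤ) ≤ N := by
    intro s hs
    obtain ⟨h1, h2, -⟩ := hmem s hs
    have := h.lt _ h1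
    have := h.lt _ h2
    omega
  have bd1 : ∀ s ∈ S, ∀ t ∈ S, |((s.1 + s.2 : ℤ) - (t.1 + t.2))| ≤ 2 * (N : ℤ) ^ 1 := by
    intro s hs t ht
    obtain ⟨h1, h2, h3, h4⟩ := bd s hs
    obtain ⟨h5, h6, h7, h8⟩ := bd t ht
    apply abs_sub_le_of_mem_Icc <;> linarith
  have bd2 : ∀ s ∈ S, ∀ t ∈ S, |((s.1 * s.2 : ℤ) - (t.1 * t.2))| ≤ 1 * (N : ℤ) ^ 2 := by
    intro s hs t ht
    obtain ⟨h1, h2, h3, h4⟩ := bd s hs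
    obtain ⟨h5, h6, h7, h8⟩ := bd t ht
    apply abs_sub_le_of_mem_Icc <;> first | positivity | nlinarith
  set γ : ℤ := (s₁.1 + s₁.2 : ℤ) - (s₂.1 + s₂.2) with hγ
  set β : ℤ := (s₁.1 * s₁.2 : ℤ) - (s₂.1 * s₂.2) with hβ
  have hdet : ∀ s ∈ S, γ * ((s.1 * s.2 : ℤ) - (s₁.1 * s₁.2)) =
      β * ((s.1 + s.2 : ℤ) - (s₁.1 + s₁.2)) := by
    intro s hs
    rw [← sub_eq_zero]
    apply eq_zero_of_intCast_eq_zero (p := p)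
    · have l1 := lin s hs
      have l2 := lin s₁ hs₁
      have l3 := lin s₂ hs₂
      by_cases hμ : μ = 0
      · subst hμ
        have e1 : (s.1 + s.2 : ZMod p) = s₁.1 + s₁.2 := by linear_combination l1 - l2
        have e2 : (s₁.1 + s₁.2 : ZMod p) = s₂.1 + s₂.2 := by linear_combination l2 - l3
        rw [hγ, hβ]; push_cast
        rw [e1, e2]; ring
      · apply mul_left_cancel₀ hμ
        rw [hγ, hβ]; push_cast
        linear_combination (-((s₁.1 + s₁.2 : ZMod p) - (s₂.1 + s₂.2))) * (l1 - l2) +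
          ((s.1 + s.2 : ZMod p) - (s₁.1 + s₁.2)) * (l2 - l3)
    · calc _ ≤ (2 * 1 + 1 * 2) * (N : ℤ) ^ 3 :=
            abs_sub_le_pow (abs_mul_le_pow (bd1 s₁ hs₁ s₂ hs₂) (bd2 s hs s₁ hs₁))
              (abs_mul_le_pow (bd2 s₁ hs₁ s₂ hs₂) (bd1 s hs s₁ hs₁))
        _ < p := h.mul_pow_lt hu1 (by norm_num) (by norm_num)
  have hγ0 : γ ≠ 0 := by
    intro h0
    have e1 : (s₁.1 + s₁.2 : ZMod p) = s₂.1 + s₂.2 := by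
      have : ((γ : ℤ) : ZMod p) = 0 := by rw [h0, Int.cast_zero]
      rw [hγ] at this; push_cast at this
      linear_combination this
    have l2 := lin s₁ hs₁
    have l3 := lin s₂ hs₂
    have hμ : μ ≠ 0 := by
      rintro rfl
      apply h.add_ne_zero _ hu1 _ hv1
      linear_combination l2
    have hβ0 : β = 0 := by
      apply eq_zero_of_intCast_eq_zero (p := p)
      · apply mul_left_cancel₀ hμ
        rw [hβ]; push_cast
        linear_combination l3 - l2 + (1 - μ * a) * e1
      · exact (bd2 s₁ hs₁ s₂ hs₂).trans_lt (h.mul_pow_lt hu1 (by norm_num) (by norm_num))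
    have : ((s₂.1 : ℤ) - s₁.1) * (s₂.1 - s₁.2) = 0 := by
      linear_combination hβ0 - hβ + (-(s₂.1 : ℤ)) * (h0 - hγ)
    rcases mul_eq_zero.1 this with h1 | h1
    · exact hne1 (by omega)
    · exact hne2 (by omega)
  set G : ℤ := (β - γ * s₁.1) * (β - γ * s₁.2) with hG
  have hG0 : G ≠ 0 := by
    have e1 : β - γ * s₁.1 = -((s₂.1 - s₁.1) * (s₂.2 - s₁.1)) := by rw [hβ, hγ]; ring
    have e2 : β - γ * s₁.2 = -((s₂.1 - s₁.2) * (s₂.2 - s₁.2)) := by rw [hβ, hγ]; ring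
    have n1 : (s₂.1 : ℤ) - s₁.1 ≠ 0 := by omega
    have n2 : (s₂.1 : ℤ) - s₁.2 ≠ 0 := by omega
    have n3 : (s₂.2 : ℤ) - s₁.1 ≠ 0 := by
      intro h0
      exact hne2 (hcross _ hs₁ _ hs₂ (by omega)).symm
    have n4 : (s₂.2 : ℤ) - s₁.2 ≠ 0 := by
      intro h0
      exact hne1 (congrArg Prod.fst (hsnd _ hs₂ _ hs₁ (by omega)))
    rw [hG, e1, e2]
    simp only [neg_mul_neg]
    positivity
  have hdvd : ∀ s ∈ S, β - γ * s.1 ∣ G := by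
    intro s hs
    refine ⟨β - γ * s.2, ?_⟩
    rw [hG]
    linear_combination -γ * hdet s hs
  have hcard : #S ≤ 2 * #(G.natAbs.divisors) := by
    calc #S = #(S.image fun s ↦ β - γ * (s.1 : ℤ)) := by
          refine (card_image_of_injOn fun s hs t ht hst ↦ hinj hs ht ?_).symm
          have : γ * (s.1 : ℤ) = γ * t.1 := by simpa using hst
          exact_mod_cast mul_left_cancel₀ hγ0 this
      _ ≤ _ := card_le_of_forall_dvd hG0 fun t ht ↦ by
          obtain ⟨s, hs, rfl⟩ := mem_image.1 ht
          exact hdvd s hs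
  have hGle : G.natAbs ≤ p ^ 3 := by
    have b1 : ∀ u : ℤ, 0 ≤ u → u ≤ N → |β - γ * u| ≤ (1 + 2 * 1) * (N : ℤ) ^ 2 := fun u h1 h2 ↦
      abs_sub_le_pow (bd2 s₁ hs₁ s₂ hs₂)
        (abs_mul_le_pow (j := 1) (β := 1) (bd1 s₁ hs₁ s₂ hs₂) (by rw [abs_of_nonneg h1]; linarith))
    obtain ⟨h1, h2, h3, h4⟩ := bd s₁ hs₁
    have b2 := abs_mul_le_pow (b1 _ h1 h2) (b1 _ h3 h4)
    have b3 := h.mul_pow_lt hu1 (c := (1 + 2 * 1) * (1 + 2 * 1)) (i := 2 + 2) (by norm_num)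
      (by norm_num)
    have b4 : G.natAbs ≤ p := by
      rw [← hG] at b2
      have := b2.trans b3.le
      rw [Int.abs_eq_natAbs] at this
      exact_mod_cast this
    exact b4.trans (Nat.le_self_pow (by norm_num) p)
  have := hD G.natAbs (by simpa using hG0) hGle
  omega

end IsBlock

/-- First elementary symmetric function. -/
def esymmOne {R : Type*} [CommRing R] (x y z : R) : R := x + y + z

/-- Second elementary symmetric function. -/
def esymmTwo {R : Type*} [CommRing R] (x y z : R) : R := x * y + x * z + y * z

/-- Third elementary symmetric function. -/
def esymmThree {R : Type*} [CommRing R] (x y z : R) : R := x * y * z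

/-- The coefficient vector of `(T + u) (T + v) (T + w)`, without the leading one. -/
def tripleCoeff (s : ℕ × ℕ × ℕ) : Fin 3 → ℤ :=
  ![esymmOne (s.1 : ℤ) s.2.1 s.2.2, esymmTwo (s.1 : ℤ) s.2.1 s.2.2,
    esymmThree (s.1 : ℤ) s.2.1 s.2.2]

/-- The sum of the reciprocals of `a + u`, `a + v`, `a + w`. -/
def recipSum {p : ℕ} (a : ZMod p) (s : ℕ × ℕ × ℕ) : ZMod p :=
  (a + s.1)⁻¹ + (a + s.2.1)⁻¹ + (a + s.2.2)⁻¹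

/-- The triples from `U` whose reciprocal sum equals `l`. -/
def recipSols {p : ℕ} (a : ZMod p) (U : Finset ℕ) (l : ZMod p) : Finset (ℕ × ℕ × ℕ) :=
  {s ∈ U ×ˢ U ×ˢ U | recipSum a s = l}

theorem mem_recipSols {p : ℕ} {a : ZMod p} {U : Finset ℕ} {l : ZMod p} {s : ℕ × ℕ × ℕ} :
    s ∈ recipSols a U l ↔ (s.1 ∈ U ∧ s.2.1 ∈ U ∧ s.2.2 ∈ U) ∧ recipSum a s = l := by
  simp [recipSols]

/-- The resultant of a monic cubic and a quadratic only depends on the cubic modulo the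
quadratic. -/
theorem prod_quadratic_eq {g d : Fin 3 → ℤ} {x y z x' y' z' : ℤ}
    (hd : d 0 = esymmOne x y z - esymmOne x' y' z' ∧ d 1 = esymmTwo x y z - esymmTwo x' y' z' ∧
      d 2 = esymmThree x y z - esymmThree x' y' z')
    (h01 : g 0 * d 1 = g 1 * d 0) (h02 : g 0 * d 2 = g 2 * d 0) (h12 : g 1 * d 2 = g 2 * d 1)
    (hg : g 0 ≠ 0 ∨ g 1 ≠ 0) :
    (g 0 * x ^ 2 - g 1 * x + g 2) * (g 0 * y ^ 2 - g 1 * y + g 2) *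
        (g 0 * z ^ 2 - g 1 * z + g 2) =
      (g 0 * x' ^ 2 - g 1 * x' + g 2) * (g 0 * y' ^ 2 - g 1 * y' + g 2) *
        (g 0 * z' ^ 2 - g 1 * z' + g 2) := by
  have hrho : ∃ ρ : ℚ, (d 0 : ℚ) = ρ * g 0 ∧ (d 1 : ℚ) = ρ * g 1 ∧ (d 2 : ℚ) = ρ * g 2 := by
    have h01' : (g 0 * d 1 : ℚ) = g 1 * d 0 := by exact_mod_cast h01
    have h02' : (g 0 * d 2 : ℚ) = g 2 * d 0 := by exact_mod_cast h02
    have h12' : (g 1 * d 2 : ℚ) = g 2 * d 1 := by exact_mod_cast h12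
    rcases hg with h | h
    · have h' : (g 0 : ℚ) ≠ 0 := by exact_mod_cast h
      refine ⟨d 0 / g 0, ?_, ?_, ?_⟩ <;> field_simp <;> linarith
    · have h' : (g 1 : ℚ) ≠ 0 := by exact_mod_cast h
      refine ⟨d 1 / g 1, ?_, ?_, ?_⟩ <;> field_simp <;> linarith
  obtain ⟨ρ, h0, h1, h2⟩ := hrho
  have key : ∀ x y z a b c : ℚ, (a * x ^ 2 - b * x + c) * (a * y ^ 2 - b * y + c) *
      (a * z ^ 2 - b * z + c) =
      a ^ 3 * esymmThree x y z ^ 2 - a ^ 2 * b * esymmThree x y z * esymmTwo x y z +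
        a ^ 2 * c * (esymmTwo x y z ^ 2 - 2 * esymmOne x y z * esymmThree x y z) +
        a * b ^ 2 * esymmOne x y z * esymmThree x y z -
        a * b * c * (esymmOne x y z * esymmTwo x y z - 3 * esymmThree x y z) +
        a * c ^ 2 * (esymmOne x y z ^ 2 - 2 * esymmTwo x y z) - b ^ 3 * esymmThree x y z +
        b ^ 2 * c * esymmTwo x y z - b * c ^ 2 * esymmOne x y z + c ^ 3 := by
    intro x y z a b c
    simp only [esymmOne, esymmTwo, esymmThree]; ring
  have E0 : esymmOne (x : ℚ) y z = esymmOne (x' : ℚ) y' z' + ρ * g 0 := by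
    rw [← h0, hd.1]; simp only [esymmOne]; push_cast; ring
  have E1 : esymmTwo (x : ℚ) y z = esymmTwo (x' : ℚ) y' z' + ρ * g 1 := by
    rw [← h1, hd.2.1]; simp only [esymmTwo]; push_cast; ring
  have E2 : esymmThree (x : ℚ) y z = esymmThree (x' : ℚ) y' z' + ρ * g 2 := by
    rw [← h2, hd.2.2]; simp only [esymmThree]; push_cast; ring
  have : ((g 0 * x ^ 2 - g 1 * x + g 2) * (g 0 * y ^ 2 - g 1 * y + g 2) *
        (g 0 * z ^ 2 - g 1 * z + g 2) : ℚ) =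
      (g 0 * x' ^ 2 - g 1 * x' + g 2) * (g 0 * y' ^ 2 - g 1 * y' + g 2) *
        (g 0 * z' ^ 2 - g 1 * z' + g 2) := by
    rw [key, key, E0, E1, E2]; ring
  exact_mod_cast this

namespace IsBlock

theorem tripleCoeff_mem {p : ℕ} {a : ZMod p} {N : ℕ} {U : Finset ℕ} {l : ZMod p}
    (h : IsBlock p a N U) {s : ℕ × ℕ × ℕ} (hs : s ∈ recipSols a U l) :
    (0 ≤ tripleCoeff s 0 ∧ tripleCoeff s 0 ≤ 3 * (N : ℤ) ^ 1) ∧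
    (0 ≤ tripleCoeff s 1 ∧ tripleCoeff s 1 ≤ 3 * (N : ℤ) ^ 2) ∧
    (0 ≤ tripleCoeff s 2 ∧ tripleCoeff s 2 ≤ 1 * (N : ℤ) ^ 3) := by
  obtain ⟨⟨h1, h2, h3⟩, h4⟩ := mem_recipSols.1 hs
  have b1 : (s.1 : ℤ) ≤ N := by exact_mod_cast (h.lt _ h1).le
  have b2 : (s.2.1 : ℤ) ≤ N := by exact_mod_cast (h.lt _ h2).le
  have b3 : (s.2.2 : ℤ) ≤ N := by exact_mod_cast (h.lt _ h3).le
  have m1 : (s.1 : ℤ) * s.2.1 ≤ N * N := by gcongr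
  have m2 : (s.1 : ℤ) * s.2.2 ≤ N * N := by gcongr
  have m3 : (s.2.1 : ℤ) * s.2.2 ≤ N * N := by gcongr
  have m4 : (s.1 : ℤ) * s.2.1 * s.2.2 ≤ N * N * N := by gcongr
  simp only [tripleCoeff, esymmOne, esymmTwo, esymmThree]
  refine ⟨⟨?_, ?_⟩, ⟨?_, ?_⟩, ⟨?_, ?_⟩⟩ <;> simp <;> first | positivity | nlinarith

variable {p : ℕ} [Fact p.Prime] {a : ZMod p} {N : ℕ} {U : Finset ℕ} {l : ZMod p}

theorem recipSum_linear (h : IsBlock p a N U) {s : ℕ × ℕ × ℕ} (hs : s ∈ recipSols a U l) :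
    (3 * a ^ 2 - l * a ^ 3) + (2 * a - l * a ^ 2) * (tripleCoeff s 0 : ZMod p) +
      (1 - l * a) * (tripleCoeff s 1 : ZMod p) + (-l) * (tripleCoeff s 2 : ZMod p) = 0 := by
  obtain ⟨⟨h1, h2, h3⟩, h4⟩ := mem_recipSols.1 hs
  have n1 := h.ne_zero _ h1
  have n2 := h.ne_zero _ h2
  have n3 := h.ne_zero _ h3
  rw [recipSum] at h4
  field_simp at h4
  simp [tripleCoeff, esymmOne, esymmTwo, esymmThree]
  linear_combination h4

/-- Fixing one of the coordinates leaves few solutions. -/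
theorem card_coord_le (h : IsBlock p a N U) {D : ℕ}
    (hD : ∀ n : ℕ, n ≠ 0 → n ≤ p ^ 3 → #n.divisors ≤ D) (l : ZMod p) (u : ℕ) :
    #{s ∈ recipSols a U l | s.1 = u} ≤ 6 * D ∧ #{s ∈ recipSols a U l | s.2.1 = u} ≤ 6 * D ∧
      #{s ∈ recipSols a U l | s.2.2 = u} ≤ 6 * D := by
  have h2 := h.card_two_le hD (l - (a + u)⁻¹)
  refine ⟨(card_le_card_of_injOn (fun s ↦ s.2) ?_ ?_).trans h2,
    (card_le_card_of_injOn (fun s ↦ (s.1, s.2.2)) ?_ ?_).trans h2,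
    (card_le_card_of_injOn (fun s ↦ (s.1, s.2.1)) ?_ ?_).trans h2⟩
  · intro s hs
    obtain ⟨hs', rfl⟩ := mem_filter.1 hs
    obtain ⟨⟨h1, h2, h3⟩, h4⟩ := mem_recipSols.1 hs'
    simp only [coe_filter, mem_product, Set.mem_ofPred_eq]
    refine ⟨⟨h2, h3⟩, ?_⟩
    rw [← h4, recipSum]; ring
  · intro s hs t ht hst
    have e1 := (mem_filter.1 hs).2
    have e2 := (mem_filter.1 ht).2
    exact Prod.ext (e1.trans e2.symm) hst
  · intro s hs
    obtain ⟨hs', rfl⟩ := mem_filter.1 hs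
    obtain ⟨⟨h1, h2, h3⟩, h4⟩ := mem_recipSols.1 hs'
    simp only [coe_filter, mem_product, Set.mem_ofPred_eq]
    refine ⟨⟨h1, h3⟩, ?_⟩
    rw [← h4, recipSum]; ring
  · intro s hs t ht hst
    have e1 := (mem_filter.1 hs).2
    have e2 := (mem_filter.1 ht).2
    simp only [Prod.mk.injEq] at hst
    exact Prod.ext hst.1 (Prod.ext (e1.trans e2.symm) hst.2)
  · intro s hs
    obtain ⟨hs', rfl⟩ := mem_filter.1 hs
    obtain ⟨⟨h1, h2, h3⟩, h4⟩ := mem_recipSols.1 hs'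
    simp only [coe_filter, mem_product, Set.mem_ofPred_eq]
    refine ⟨⟨h1, h2⟩, ?_⟩
    rw [← h4, recipSum]; ring
  · intro s hs t ht hst
    have e1 := (mem_filter.1 hs).2
    have e2 := (mem_filter.1 ht).2
    simp only [Prod.mk.injEq] at hst
    exact Prod.ext hst.1 (Prod.ext hst.2 (e1.trans e2.symm))

theorem card_recipSols_le (h : IsBlock p a N U) {D : ℕ}
    (hD : ∀ n : ℕ, n ≠ 0 → n ≤ p ^ 3 → #n.divisors ≤ D) (l : ZMod p) :
    #(recipSols a U l) ≤ 6 * D * N := by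
  calc #(recipSols a U l) ≤ 6 * D * #(range N) :=
        card_le_mul_card_image_of_maps_to (f := fun s : ℕ × ℕ × ℕ ↦ s.1)
          (fun s hs ↦ mem_range.2 (h.lt _ (mem_recipSols.1 hs).1.1)) (6 * D)
          fun u _ ↦ (h.card_coord_le hD l u).1
    _ = _ := by rw [card_range]

/-- If the coefficient vectors of all solutions lie on a line, there are few of them. -/
theorem card_recipSols_le_of_collinear (h : IsBlock p a N U) {D : ℕ}
    (hD : ∀ n : ℕ, n ≠ 0 → n ≤ p ^ 3 → #n.divisors ≤ D) (hl : l ≠ 0)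
    (hcol : ∀ s ∈ recipSols a U l, ∀ t ∈ recipSols a U l, ∀ r ∈ recipSols a U l, ∀ i j,
      (tripleCoeff s - tripleCoeff t) i * (tripleCoeff s - tripleCoeff r) j =
        (tripleCoeff s - tripleCoeff t) j * (tripleCoeff s - tripleCoeff r) i) :
    #(recipSols a U l) ≤ 54 * D ^ 2 := by
  set S := recipSols a U l with hS
  have hD1 : 1 ≤ D := by
    simpa using hD 1 one_ne_zero (Nat.one_le_pow _ _ (Fact.out : p.Prime).pos)
  rcases S.eq_empty_or_nonempty with hemp | ⟨s, hs⟩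
  · simp [hemp]
  let V : Finset ℕ := {s.1, s.2.1, s.2.2}
  have hV : #V ≤ 3 := card_le_three
  by_cases hall : ∀ t ∈ S, t.1 ∈ V ∨ t.2.1 ∈ V ∨ t.2.2 ∈ V
  · have hsub : S ⊆ V.biUnion fun u ↦ {s ∈ S | s.1 = u} ∪ ({s ∈ S | s.2.1 = u} ∪
        {s ∈ S | s.2.2 = u}) := by
      intro t ht
      simp only [mem_biUnion, mem_union, mem_filter]
      rcases hall t ht with h1 | h1 | h1
      · exact ⟨_, h1, Or.inl ⟨ht, rfl⟩⟩
      · exact ⟨_, h1, Or.inr (Or.inl ⟨ht, rfl⟩)⟩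
      · exact ⟨_, h1, Or.inr (Or.inr ⟨ht, rfl⟩)⟩
    calc #S ≤ _ := card_le_card hsub
      _ ≤ #V * (18 * D) := card_biUnion_le_card_mul _ _ _ fun u _ ↦ by
          obtain ⟨h1, h2, h3⟩ := h.card_coord_le hD l u
          rw [← hS] at h1 h2 h3
          refine (card_union_le _ _).trans ?_
          have := card_union_le {s ∈ S | s.2.1 = u} {s ∈ S | s.2.2 = u}
          omega
      _ ≤ 54 * D ^ 2 := by nlinarith
  push Not at hall
  obtain ⟨t, ht, hn1, hn2, hn3⟩ := hall
  simp only [V, mem_insert, mem_singleton, not_or] at hn1 hn2 hn3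
  set g : Fin 3 → ℤ := tripleCoeff s - tripleCoeff t with hg
  have hg0 : g 0 = esymmOne (s.1 : ℤ) s.2.1 s.2.2 - esymmOne (t.1 : ℤ) t.2.1 t.2.2 := rfl
  have hg1 : g 1 = esymmTwo (s.1 : ℤ) s.2.1 s.2.2 - esymmTwo (t.1 : ℤ) t.2.1 t.2.2 := rfl
  have hg2 : g 2 = esymmThree (s.1 : ℤ) s.2.1 s.2.2 - esymmThree (t.1 : ℤ) t.2.1 t.2.2 := rfl
  let q : ℤ → ℤ := fun u ↦ g 0 * u ^ 2 - g 1 * u + g 2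
  have hq : ∀ u ∈ V, q u = -((t.1 - u) * (t.2.1 - u) * (t.2.2 - u)) := by
    intro u hu
    simp only [V, mem_insert, mem_singleton] at hu
    simp only [q, hg0, hg1, hg2, esymmOne, esymmTwo, esymmThree]
    rcases hu with rfl | rfl | rfl <;> ring
  have hUmem := (mem_recipSols.1 hs).1
  have hUmem' := (mem_recipSols.1 ht).1
  have hVU : ∀ u ∈ V, u < N := by
    intro u hu
    simp only [V, mem_insert, mem_singleton] at hu
    rcases hu with rfl | rfl | rfl
    exacts [h.lt _ hUmem.1, h.lt _ hUmem.2.1, h.lt _ hUmem.2.2]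
  have hqne : ∀ u ∈ V, q u ≠ 0 := by
    intro u hu
    have hu' := hq u hu
    simp only [V, mem_insert, mem_singleton] at hu
    have n1 : (t.1 : ℤ) - u ≠ 0 := by omega
    have n2 : (t.2.1 : ℤ) - u ≠ 0 := by omega
    have n3 : (t.2.2 : ℤ) - u ≠ 0 := by omega
    rw [hu']
    exact neg_ne_zero.2 (mul_ne_zero (mul_ne_zero n1 n2) n3)
  have hqle : ∀ u ∈ V, |q u| ≤ 1 * (N : ℤ) ^ 3 := by
    intro u hu
    have b := hVU u hu
    have b1 := h.lt _ hUmem'.1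
    have b2 := h.lt _ hUmem'.2.1
    have b3 := h.lt _ hUmem'.2.2
    have c : ∀ v : ℕ, v < N → |(v : ℤ) - u| ≤ 1 * (N : ℤ) ^ 1 := fun v hv ↦
      abs_sub_le_of_mem_Icc (by positivity) (by rw [pow_one]; omega) (by positivity)
        (by rw [pow_one]; omega)
    rw [hq u hu, abs_neg]
    simpa using abs_mul_le_pow (abs_mul_le_pow (c _ b1) (c _ b2)) (c _ b3)
  have m1 : s.1 ∈ V := by simp [V]
  have m2 : s.2.1 ∈ V := by simp [V]
  have m3 : s.2.2 ∈ V := by simp [V]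
  have hg01 : g 0 ≠ 0 ∨ g 1 ≠ 0 := by
    by_contra! h01
    obtain ⟨h0, h1⟩ := h01
    have e0 : ((g 0 : ℤ) : ZMod p) = 0 := by rw [h0, Int.cast_zero]
    have e1 : ((g 1 : ℤ) : ZMod p) = 0 := by rw [h1, Int.cast_zero]
    have l1 := h.recipSum_linear hs
    have l2 := h.recipSum_linear ht
    simp only [hg, Pi.sub_apply, Int.cast_sub] at e0 e1
    have e2 : g 2 = 0 := by
      apply eq_zero_of_intCast_eq_zero (p := p)
      · apply mul_left_cancel₀ hl
        simp only [hg, Pi.sub_apply, Int.cast_sub]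
        linear_combination l2 - l1 + (2 * a - l * a ^ 2) * e0 + (1 - l * a) * e1
      · obtain ⟨-, -, h5, h6⟩ := h.tripleCoeff_mem hs
        obtain ⟨-, -, h7, h8⟩ := h.tripleCoeff_mem ht
        exact (abs_sub_le_of_mem_Icc h5 h6 h7 h8).trans_lt
          (h.mul_pow_lt hUmem.1 (by norm_num) (by norm_num))
    exact hqne _ m1 (by simp [q, h0, h1, e2])
  set G : ℤ := q s.1 * q s.2.1 * q s.2.2 with hG
  have hG0 : G ≠ 0 := mul_ne_zero (mul_ne_zero (hqne _ m1) (hqne _ m2)) (hqne _ m3)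
  have hGle : G.natAbs ≤ p ^ 3 := by
    have b2 := abs_mul_le_pow (abs_mul_le_pow (hqle _ m1) (hqle _ m2)) (hqle _ m3)
    have b3 := h.mul_pow_lt hUmem.1 (c := 1 * 1 * 1) (i := 3 + 3 + 3) (by norm_num) (by norm_num)
    have := b2.trans b3.le
    rw [← hG, Int.abs_eq_natAbs] at this
    exact (by exact_mod_cast this : G.natAbs ≤ p).trans (Nat.le_self_pow (by norm_num) p)
  have hdvd : ∀ r ∈ S, G = q r.1 * q r.2.1 * q r.2.2 := by
    intro r hr
    exact prod_quadratic_eq (g := g) (d := tripleCoeff s - tripleCoeff r) ⟨rfl, rfl, rfl⟩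
      (hcol s hs t ht r hr 0 1) (hcol s hs t ht r hr 0 2) (hcol s hs t ht r hr 1 2) hg01
  let W : Finset ℕ := {u ∈ U | q u ∣ G}
  have hW : #W ≤ 2 * (2 * D) := by
    refine (card_le_mul_card_image (f := fun u : ℕ ↦ q u) W 2 ?_).trans ?_
    · intro v _
      by_contra! hlt
      obtain ⟨x, y, z, hx, hy, hz, hxy, hxz, hyz⟩ := two_lt_card_iff.1 hlt
      have ex := (mem_filter.1 hx).2
      have ey := (mem_filter.1 hy).2
      have ez := (mem_filter.1 hz).2
      simp only [q] at ex ey ez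
      have f1 : ((x : ℤ) - y) * (g 0 * (x + y) - g 1) = 0 := by linear_combination ex - ey
      have f2 : ((x : ℤ) - z) * (g 0 * (x + z) - g 1) = 0 := by linear_combination ex - ez
      have f1' := (mul_eq_zero.1 f1).resolve_left (by omega)
      have f2' := (mul_eq_zero.1 f2).resolve_left (by omega)
      have f3 : g 0 * ((y : ℤ) - z) = 0 := by linear_combination f1' - f2'
      have f4 := (mul_eq_zero.1 f3).resolve_right (by omega)
      rw [f4] at f1'
      rcases hg01 with h1 | h1
      · exact h1 f4
      · exact h1 (by linarith)
    · gcongr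
      refine (card_le_of_forall_dvd hG0 ?_).trans
        (Nat.mul_le_mul_left 2 (hD G.natAbs (by simpa using hG0) hGle))
      intro v hv
      obtain ⟨u, hu, rfl⟩ := mem_image.1 hv
      exact (mem_filter.1 hu).2
  have hfin : #S ≤ #(W ×ˢ W) := by
    refine card_le_card_of_injOn (fun r ↦ (r.1, r.2.1)) ?_ ?_
    · intro r hr
      have hr' := hdvd r hr
      have hm := (mem_recipSols.1 hr).1
      simp only [coe_product, Set.mem_prod, mem_coe, W, mem_filter]
      exact ⟨⟨hm.1, hr' ▸ ⟨q r.2.1 * q r.2.2, by ring⟩⟩,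
        ⟨hm.2.1, hr' ▸ ⟨q r.1 * q r.2.2, by ring⟩⟩⟩
    · intro r hr r' hr' hrr
      simp only [Prod.mk.injEq] at hrr
      obtain ⟨⟨-, -, i3⟩, i4⟩ := mem_recipSols.1 hr
      obtain ⟨⟨-, -, j3⟩, j4⟩ := mem_recipSols.1 hr'
      rw [← j4, recipSum, recipSum, hrr.1, hrr.2] at i4
      exact Prod.ext hrr.1 (Prod.ext hrr.2 (h.inv_inj i3 j3 (add_left_cancel i4)))
  rw [card_product] at hfin
  calc #S ≤ #W * #W := hfin
    _ ≤ (2 * (2 * D)) * (2 * (2 * D)) := Nat.mul_le_mul hW hW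
    _ ≤ 54 * D ^ 2 := by nlinarith

end IsBlock

/-- The linear form `2 A T + B` evaluated on the three entries of a triple satisfies a relation
`e₂(x) e₃(y) = e₂(y) e₃(x)`. -/
def SameRatio (A B : ℤ) (s t : ℕ × ℕ × ℕ) : Prop :=
  esymmTwo (2 * A * s.1 + B) (2 * A * s.2.1 + B) (2 * A * s.2.2 + B) *
      esymmThree (2 * A * t.1 + B) (2 * A * t.2.1 + B) (2 * A * t.2.2 + B) =
    esymmTwo (2 * A * t.1 + B) (2 * A * t.2.1 + B) (2 * A * t.2.2 + B) *
      esymmThree (2 * A * s.1 + B) (2 * A * s.2.1 + B) (2 * A * s.2.2 + B)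

theorem SameRatio.of_proportional {A B A' B' : ℤ} {s t : ℕ × ℕ × ℕ} (h : SameRatio A' B' s t)
    (hA : A' ≠ 0) (hAB : B * A' = B' * A) : SameRatio A B s t := by
  unfold SameRatio at *
  have hx : ∀ u : ℤ, (2 * A * u + B) * A' = (2 * A' * u + B') * A := by
    intro u; linear_combination hAB
  apply mul_left_cancel₀ (pow_ne_zero 5 hA)
  have h2 : ∀ x y z : ℤ, A' ^ 2 * esymmTwo (2 * A * x + B) (2 * A * y + B) (2 * A * z + B) =
      A ^ 2 * esymmTwo (2 * A' * x + B') (2 * A' * y + B') (2 * A' * z + B') := by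
    intro x y z
    calc _ = esymmTwo ((2 * A * x + B) * A') ((2 * A * y + B) * A') ((2 * A * z + B) * A') := by
          simp only [esymmTwo]; ring
      _ = _ := by rw [hx, hx, hx]; simp only [esymmTwo]; ring
  have h3 : ∀ x y z : ℤ, A' ^ 3 * esymmThree (2 * A * x + B) (2 * A * y + B) (2 * A * z + B) =
      A ^ 3 * esymmThree (2 * A' * x + B') (2 * A' * y + B') (2 * A' * z + B') := by
    intro x y z
    calc _ = esymmThree ((2 * A * x + B) * A') ((2 * A * y + B) * A') ((2 * A * z + B) * A') := by
          simp only [esymmThree]; ring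
      _ = _ := by rw [hx, hx, hx]; simp only [esymmThree]; ring
  calc _ = (A' ^ 2 * esymmTwo (2 * A * s.1 + B) (2 * A * s.2.1 + B) (2 * A * s.2.2 + B)) *
      (A' ^ 3 * esymmThree (2 * A * t.1 + B) (2 * A * t.2.1 + B) (2 * A * t.2.2 + B)) := by ring
    _ = (A' ^ 2 * esymmTwo (2 * A * t.1 + B) (2 * A * t.2.1 + B) (2 * A * t.2.2 + B)) *
      (A' ^ 3 * esymmThree (2 * A * s.1 + B) (2 * A * s.2.1 + B) (2 * A * s.2.2 + B)) := by
        rw [h2, h3, h2, h3]; linear_combination A ^ 5 * h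
    _ = _ := by ring

namespace IsBlock

variable {p : ℕ} [Fact p.Prime] {a : ZMod p} {N : ℕ} {U : Finset ℕ} {l : ZMod p}

theorem two_ne_zero (h : IsBlock p a N U) {u : ℕ} (hu : u ∈ U) : (2 : ZMod p) ≠ 0 := by
  intro h2
  have := h.add_ne_zero u hu u hu
  rw [← two_mul, h2, zero_mul] at this
  exact this rfl

theorem exists_sameRatio (h : IsBlock p a N U) (hl : l ≠ 0)
    (hcol : ¬ ∀ s ∈ recipSols a U l, ∀ t ∈ recipSols a U l, ∀ r ∈ recipSols a U l, ∀ i j,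
      (tripleCoeff s - tripleCoeff t) i * (tripleCoeff s - tripleCoeff r) j =
        (tripleCoeff s - tripleCoeff t) j * (tripleCoeff s - tripleCoeff r) i) :
    ∃ A B : ℤ, (A : ZMod p) ≠ 0 ∧ (B : ZMod p) = 2 * a * A ∧ |A| ≤ 144 * (N : ℤ) ^ 8 ∧
      |B| ≤ 1008 * (N : ℤ) ^ 9 ∧
      ∀ s ∈ recipSols a U l, ∀ t ∈ recipSols a U l, SameRatio A B s t := by
  push Not at hcol
  obtain ⟨s, hs, t, ht, r, hr, i, j, hij⟩ := hcol
  have hu := (mem_recipSols.1 hs).1.1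
  set e := tripleCoeff s - tripleCoeff t with he
  set f := tripleCoeff s - tripleCoeff r with hf
  have be : ∀ t ∈ recipSols a U l, |(tripleCoeff s - tripleCoeff t) 0| ≤ 3 * (N : ℤ) ^ 1 ∧
      |(tripleCoeff s - tripleCoeff t) 1| ≤ 3 * (N : ℤ) ^ 2 ∧
      |(tripleCoeff s - tripleCoeff t) 2| ≤ 1 * (N : ℤ) ^ 3 := by
    intro t ht
    obtain ⟨⟨a1, a2⟩, ⟨a3, a4⟩, ⟨a5, a6⟩⟩ := h.tripleCoeff_mem hs
    obtain ⟨⟨b1, b2⟩, ⟨b3, b4⟩, ⟨b5, b6⟩⟩ := h.tripleCoeff_mem ht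
    exact ⟨abs_sub_le_of_mem_Icc a1 a2 b1 b2, abs_sub_le_of_mem_Icc a3 a4 b3 b4,
      abs_sub_le_of_mem_Icc a5 a6 b5 b6⟩
  obtain ⟨be0, be1, be2⟩ := be t ht
  obtain ⟨bf0, bf1, bf2⟩ := be r hr
  rw [← he] at be0 be1 be2
  rw [← hf] at bf0 bf1 bf2
  obtain ⟨n0, hn0⟩ : ∃ n, n = e 1 * f 2 - e 2 * f 1 := ⟨_, rfl⟩
  obtain ⟨n1, hn1⟩ : ∃ n, n = e 2 * f 0 - e 0 * f 2 := ⟨_, rfl⟩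
  obtain ⟨n2, hn2⟩ : ∃ n, n = e 0 * f 1 - e 1 * f 0 := ⟨_, rfl⟩
  have bn0 : |n0| ≤ (3 * 1 + 1 * 3) * (N : ℤ) ^ 5 := by
    rw [hn0]; exact abs_sub_le_pow (abs_mul_le_pow be1 bf2) (abs_mul_le_pow be2 bf1)
  have bn1 : |n1| ≤ (1 * 3 + 3 * 1) * (N : ℤ) ^ 4 := by
    rw [hn1]; exact abs_sub_le_pow (abs_mul_le_pow be2 bf0) (abs_mul_le_pow be0 bf2)
  have bn2 : |n2| ≤ (3 * 3 + 3 * 3) * (N : ℤ) ^ 3 := by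
    rw [hn2]; exact abs_sub_le_pow (abs_mul_le_pow be0 bf1) (abs_mul_le_pow be1 bf0)
  obtain ⟨w0, hw0⟩ : ∃ w, w = 2 * a - l * a ^ 2 := ⟨_, rfl⟩
  obtain ⟨w1, hw1⟩ : ∃ w, w = 1 - l * a := ⟨_, rfl⟩
  have ls := h.recipSum_linear hs
  have le : w0 * (e 0 : ZMod p) + w1 * (e 1 : ZMod p) - l * (e 2 : ZMod p) = 0 := by
    have lt := h.recipSum_linear ht
    simp only [he, Pi.sub_apply, Int.cast_sub, hw0, hw1]
    linear_combination ls - lt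
  have lf : w0 * (f 0 : ZMod p) + w1 * (f 1 : ZMod p) - l * (f 2 : ZMod p) = 0 := by
    have lt := h.recipSum_linear hr
    simp only [hf, Pi.sub_apply, Int.cast_sub, hw0, hw1]
    linear_combination ls - lt
  have hk0 : l * (n0 : ZMod p) = -(n2 * w0) := by
    rw [hn0, hn2]; push_cast
    linear_combination (f 1 : ZMod p) * le - (e 1 : ZMod p) * lf
  have hk1 : l * (n1 : ZMod p) = -(n2 * w1) := by
    rw [hn1, hn2]; push_cast
    linear_combination (-(f 0 : ZMod p)) * le + (e 0 : ZMod p) * lf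
  obtain ⟨κ, hκ⟩ : ∃ κ : ZMod p, (n2 : ZMod p) = -(κ * l) := ⟨-(n2 / l), by field_simp⟩
  have k0 : (n0 : ZMod p) = κ * w0 := by
    apply mul_left_cancel₀ hl; rw [hk0, hκ]; ring
  have k1 : (n1 : ZMod p) = κ * w1 := by
    apply mul_left_cancel₀ hl; rw [hk1, hκ]; ring
  have hκ0 : κ ≠ 0 := by
    rintro rfl
    have z0 : n0 = 0 := eq_zero_of_intCast_eq_zero (p := p) (by rw [k0, zero_mul])
      (bn0.trans_lt (h.mul_pow_lt hu (by norm_num) (by norm_num)))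
    have z1 : n1 = 0 := eq_zero_of_intCast_eq_zero (p := p) (by rw [k1, zero_mul])
      (bn1.trans_lt (h.mul_pow_lt hu (by norm_num) (by norm_num)))
    have z2 : n2 = 0 := eq_zero_of_intCast_eq_zero (p := p) (by rw [hκ, zero_mul, neg_zero])
      (bn2.trans_lt (h.mul_pow_lt hu (by norm_num) (by norm_num)))
    rw [hn0] at z0
    rw [hn1] at z1
    rw [hn2] at z2
    apply hij
    fin_cases i <;> fin_cases j <;> simp <;> linarith
  have hn2ne : n2 ≠ 0 := by
    rintro h0
    rw [h0, Int.cast_zero, eq_comm, neg_eq_zero] at hκ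
    exact mul_ne_zero hκ0 hl hκ
  obtain ⟨m, hm⟩ : ∃ m, m = -(n0 * tripleCoeff s 0 + n1 * tripleCoeff s 1 +
    n2 * tripleCoeff s 2) := ⟨_, rfl⟩
  have bm : |m| ≤ ((3 * 1 + 1 * 3) * 3 + (1 * 3 + 3 * 1) * 3 + (3 * 3 + 3 * 3) * 1) *
      (N : ℤ) ^ 6 := by
    obtain ⟨⟨a1, a2⟩, ⟨a3, a4⟩, ⟨a5, a6⟩⟩ := h.tripleCoeff_mem hs
    rw [hm, abs_neg]
    refine abs_add_le_pow (abs_add_le_pow (abs_mul_le_pow (i := 5) (j := 1) bn0 ?_)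
      (abs_mul_le_pow (i := 4) (j := 2) bn1 ?_)) (abs_mul_le_pow (i := 3) (j := 3) bn2 ?_) <;>
    rwa [abs_of_nonneg (by assumption)]
  have km : (m : ZMod p) = κ * (3 * a ^ 2 - l * a ^ 3) := by
    rw [hm]; push_cast
    rw [k0, k1, hκ, hw0, hw1]
    linear_combination (-κ) * ls
  have hrel : ∀ t ∈ recipSols a U l, m + n0 * tripleCoeff t 0 + n1 * tripleCoeff t 1 +
      n2 * tripleCoeff t 2 = 0 := by
    intro t ht
    have heq : m + n0 * tripleCoeff t 0 + n1 * tripleCoeff t 1 + n2 * tripleCoeff t 2 =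
        -(n0 * (tripleCoeff s - tripleCoeff t) 0 + n1 * (tripleCoeff s - tripleCoeff t) 1 +
          n2 * (tripleCoeff s - tripleCoeff t) 2) := by
      rw [hm]; simp only [Pi.sub_apply]; ring
    apply eq_zero_of_intCast_eq_zero (p := p)
    · push_cast
      rw [k0, k1, hκ, km, hw0, hw1]
      linear_combination κ * h.recipSum_linear ht
    · rw [heq, abs_neg]
      obtain ⟨b0, b1, b2⟩ := be t ht
      refine (abs_add_le_pow (abs_add_le_pow (abs_mul_le_pow (i := 5) (j := 1) bn0 b0)
        (abs_mul_le_pow (i := 4) (j := 2) bn1 b1))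
        (abs_mul_le_pow (i := 3) (j := 3) bn2 b2)).trans_lt
        (h.mul_pow_lt hu (by norm_num) (by norm_num))
  norm_num at bn0 bn1 bn2 bm
  obtain ⟨A, hA⟩ : ∃ A, A = n0 * n2 - n1 * n1 := ⟨_, rfl⟩
  obtain ⟨B, hB⟩ : ∃ B, B = m * n2 - n0 * n1 := ⟨_, rfl⟩
  obtain ⟨C, hC⟩ : ∃ C, C = m * n1 - n0 * n0 := ⟨_, rfl⟩
  have bA : |A| ≤ (6 * 18 + 6 * 6) * (N : ℤ) ^ 8 := by
    rw [hA]; exact abs_sub_le_pow (abs_mul_le_pow bn0 bn2) (abs_mul_le_pow bn1 bn1)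
  have bB : |B| ≤ (54 * 18 + 6 * 6) * (N : ℤ) ^ 9 := by
    rw [hB]; exact abs_sub_le_pow (abs_mul_le_pow bm bn2) (abs_mul_le_pow bn0 bn1)
  have bC : |C| ≤ (54 * 6 + 6 * 6) * (N : ℤ) ^ 10 := by
    rw [hC]; exact abs_sub_le_pow (abs_mul_le_pow bm bn1) (abs_mul_le_pow bn0 bn0)
  norm_num at bA bB bC
  have kA : (A : ZMod p) = -κ ^ 2 := by
    rw [hA]; push_cast; rw [k0, k1, hκ, hw0, hw1]; ring
  have kB : (B : ZMod p) = 2 * a * A := by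
    rw [kA, hB]; push_cast; rw [k0, k1, hκ, km, hw0, hw1]; ring
  have kC : (C : ZMod p) = -(κ ^ 2 * a ^ 2) := by
    rw [hC]; push_cast; rw [k0, k1, km, hw0, hw1]; ring
  have hdisc : B * B - (4 * A) * C = 0 := by
    apply eq_zero_of_intCast_eq_zero (p := p)
    · push_cast; rw [kB, kC, kA]; ring
    · have b4A : |4 * A| ≤ 576 * (N : ℤ) ^ 8 := by
        rw [abs_mul, show |(4 : ℤ)| = 4 from rfl]; linarith
      exact (abs_sub_le_pow (i := 18) (abs_mul_le_pow bB bB) (abs_mul_le_pow b4A bC)).trans_lt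
        (h.mul_pow_lt hu (by norm_num) (by norm_num))
  refine ⟨A, B, ?_, kB, bA, bB, ?_⟩
  · rw [kA]; exact neg_ne_zero.2 (pow_ne_zero 2 hκ0)
  have hbase : ∀ t ∈ recipSols a U l,
      n2 * esymmThree (2 * A * t.1 + B) (2 * A * t.2.1 + B) (2 * A * t.2.2 + B) =
      -(2 * A * n1 - B * n2) *
        esymmTwo (2 * A * t.1 + B) (2 * A * t.2.1 + B) (2 * A * t.2.2 + B) := by
    intro t ht
    have hx := hrel t ht
    have c1 : n2 * C - n1 * B + n0 * A = 0 := by rw [hA, hB, hC]; ring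
    have c2 : n1 * C - n0 * B + m * A = 0 := by rw [hA, hB, hC]; ring
    have F0 : tripleCoeff t 0 = esymmOne (t.1 : ℤ) t.2.1 t.2.2 := rfl
    have F1 : tripleCoeff t 1 = esymmTwo (t.1 : ℤ) t.2.1 t.2.2 := rfl
    have F2 : tripleCoeff t 2 = esymmThree (t.1 : ℤ) t.2.1 t.2.2 := rfl
    rw [F0, F1, F2] at hx
    generalize (t.1 : ℤ) = x at *
    generalize (t.2.1 : ℤ) = y at *
    generalize (t.2.2 : ℤ) = z at *
    have S2 : esymmTwo (2 * A * x + B) (2 * A * y + B) (2 * A * z + B) =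
      4 * A ^ 2 * esymmTwo x y z + 4 * A * B * esymmOne x y z + 3 * B ^ 2 := by
      simp only [esymmOne, esymmTwo]; ring
    have S3 : esymmThree (2 * A * x + B) (2 * A * y + B) (2 * A * z + B) =
      8 * A ^ 3 * esymmThree x y z + 4 * A ^ 2 * B * esymmTwo x y z +
        2 * A * B ^ 2 * esymmOne x y z + B ^ 3 := by
      simp only [esymmOne, esymmTwo, esymmThree]; ring
    rw [S2, S3]
    generalize esymmOne x y z = E1 at *
    generalize esymmTwo x y z = E2 at *
    generalize esymmThree x y z = E3 at *
    linear_combination 8 * A ^ 3 * hx + (-(2 * A * E1 * n2) - 2 * B * n2 - 2 * A * n1) * hdisc -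
      (8 * A ^ 2 * E1 + 8 * A * B) * c1 - 8 * A ^ 2 * c2
  intro s hs t ht
  unfold SameRatio
  apply mul_left_cancel₀ hn2ne
  have h1 := hbase s hs
  have h2 := hbase t ht
  generalize esymmTwo (2 * A * (s.1 : ℤ) + B) (2 * A * s.2.1 + B) (2 * A * s.2.2 + B) = P at *
  generalize esymmTwo (2 * A * (t.1 : ℤ) + B) (2 * A * t.2.1 + B) (2 * A * t.2.2 + B) = Q at *
  linear_combination P * h2 - Q * h1

/-- Away from `l = 0`, either there are few solutions, or all solutions satisfy a relation over
the rationals which does not depend on `l`. -/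
theorem card_recipSols_le_or (h : IsBlock p a N U) {D : ℕ}
    (hD : ∀ n : ℕ, n ≠ 0 → n ≤ p ^ 3 → #n.divisors ≤ D) :
    (∀ l : ZMod p, l ≠ 0 → #(recipSols a U l) ≤ 54 * D ^ 2) ∨
    ∃ A B : ℤ, (A : ZMod p) ≠ 0 ∧ (B : ZMod p) = 2 * a * A ∧ |A| ≤ 144 * (N : ℤ) ^ 8 ∧
      |B| ≤ 1008 * (N : ℤ) ^ 9 ∧ ∀ l : ZMod p, l ≠ 0 → #(recipSols a U l) ≤ 54 * D ^ 2 ∨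
        ∀ s ∈ recipSols a U l, ∀ t ∈ recipSols a U l, SameRatio A B s t := by
  by_contra! hcon
  obtain ⟨⟨l, hl, hlt⟩, hcon⟩ := hcon
  obtain ⟨A, B, hA, hB, bA, bB, hAB⟩ := h.exists_sameRatio hl fun hcol ↦
    absurd (h.card_recipSols_le_of_collinear hD hl hcol) (not_le.2 hlt)
  obtain ⟨l', hl', hlt', s, hs, t, ht, hst⟩ := hcon A B hA hB bA bB
  obtain ⟨A', B', hA', hB', bA', bB', hAB'⟩ := h.exists_sameRatio hl' fun hcol ↦
    absurd (h.card_recipSols_le_of_collinear hD hl' hcol) (not_le.2 hlt')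
  have hne : A' ≠ 0 := by rintro rfl; simp at hA'
  refine hst ((hAB' s hs t ht).of_proportional hne (sub_eq_zero.1 ?_))
  apply eq_zero_of_intCast_eq_zero (p := p)
  · push_cast; rw [hB, hB']; ring
  · exact (abs_sub_le_pow (i := 17) (abs_mul_le_pow bB bA') (abs_mul_le_pow bB' bA)).trans_lt
        (h.mul_pow_lt (mem_recipSols.1 hs).1.1 (by norm_num) (by norm_num))

end IsBlock

theorem exists_factorization_lcm_eq {ι : Type*} [DecidableEq ι] {S : Finset ι} (hS : S.Nonempty)
    (n : ι → ℕ) (hn : ∀ i, n i ≠ 0) (q : ℕ) :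
    ∃ i ∈ S, (S.lcm n).factorization q = (n i).factorization q := by
  induction hS using Finset.Nonempty.cons_induction with
  | singleton a => exact ⟨a, mem_singleton_self a, by simp⟩
  | cons a S ha hS ih =>
    obtain ⟨i, hi, h⟩ := ih
    have hne : S.lcm n ≠ 0 := by rw [Ne, Finset.lcm_eq_zero_iff]; simp [hn]
    have h2 : ((cons a S ha).lcm n).factorization q =
        max ((n a).factorization q) ((n i).factorization q) := by
      rw [cons_eq_insert, Finset.lcm_insert, ← h]
      exact DFunLike.congr_fun (Nat.factorization_lcm (hn a) hne) q
    rcases max_choice ((n a).factorization q) ((n i).factorization q) with h3 | h3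
    · exact ⟨a, mem_cons_self a S, h2.trans h3⟩
    · exact ⟨i, mem_cons_of_mem hi, h2.trans h3⟩

/-- If each member of a finite family divides the lcm of the other members, then the square of
the lcm of the family divides its product. -/
theorem lcm_sq_dvd_prod {ι : Type*} [DecidableEq ι] [Fintype ι] [Nontrivial ι]
    (n : ι → ℕ) (hn : ∀ i, n i ≠ 0) (h : ∀ i, n i ∣ (univ.erase i).lcm n) :
    (univ.lcm n) ^ 2 ∣ ∏ i, n i := by
  have hL : univ.lcm n ≠ 0 := by rw [Ne, Finset.lcm_eq_zero_iff]; simp [hn]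
  rw [← Nat.factorization_prime_le_iff_dvd (pow_ne_zero 2 hL) (prod_ne_zero_iff.2 fun i _ ↦ hn i)]
  intro q hq
  rw [Nat.factorization_pow, Nat.factorization_prod fun i _ ↦ hn i]
  simp only [Finsupp.smul_apply, smul_eq_mul, Finsupp.finsetSum_apply]
  obtain ⟨i, -, hi⟩ := exists_factorization_lcm_eq univ_nonempty n hn q
  have hne : (univ.erase i : Finset ι).Nonempty := by
    obtain ⟨j, hj⟩ := exists_ne i
    exact ⟨j, mem_erase.2 ⟨hj, mem_univ j⟩⟩
  obtain ⟨j, hj, hj'⟩ := exists_factorization_lcm_eq hne n hn q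
  have hL' : (univ.erase i).lcm n ≠ 0 := by rw [Ne, Finset.lcm_eq_zero_iff]; simp [hn]
  have h1 : (n i).factorization q ≤ (n j).factorization q := by
    rw [← hj']
    exact (Nat.factorization_le_iff_dvd (hn i) hL').2 (h i) q
  calc 2 * (univ.lcm n).factorization q ≤ (n i).factorization q + (n j).factorization q := by
        rw [hi]; omega
    _ = ∑ k ∈ {i, j}, (n k).factorization q := by rw [sum_pair (ne_of_mem_erase hj).symm]
    _ ≤ _ := sum_le_univ_sum_of_nonneg fun _ ↦ Nat.zero_le _

/-- If the reciprocals of nonzero integers add up to zero, each of them divides the lcm of the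
others. -/
theorem natAbs_dvd_lcm_erase {ι : Type*} [DecidableEq ι] [Fintype ι] (y : ι → ℤ)
    (hy : ∀ i, y i ≠ 0) (h : ∑ i, (1 / (y i : ℚ)) = 0) (i : ι) :
    (y i).natAbs ∣ (univ.erase i).lcm fun j ↦ (y j).natAbs := by
  set L := (univ.erase i).lcm fun j ↦ (y j).natAbs with hL
  have hd : ∀ j ∈ univ.erase i, y j ∣ (L : ℤ) := fun j hj ↦
    Int.natAbs_dvd.1 (Int.natCast_dvd_natCast.2 (Finset.dvd_lcm (f := fun j ↦ (y j).natAbs) hj))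
  have hi : (y i : ℚ) ≠ 0 := by exact_mod_cast hy i
  rw [← add_sum_erase _ _ (mem_univ i)] at h
  have h2 : (L : ℚ) = y i * ((-∑ j ∈ univ.erase i, L / y j : ℤ) : ℚ) := by
    have h3 : ((∑ j ∈ univ.erase i, (L : ℤ) / y j : ℤ) : ℚ) =
        L * ∑ j ∈ univ.erase i, 1 / (y j : ℚ) := by
      rw [mul_sum]
      push_cast
      refine sum_congr rfl fun j hj ↦ ?_
      rw [Int.cast_div (hd j hj) (by exact_mod_cast hy j)]
      push_cast
      ring
    rw [Int.cast_neg, h3]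
    have h4 : ∑ j ∈ univ.erase i, 1 / (y j : ℚ) = -(1 / y i) := by linarith
    rw [h4]
    field_simp
  have h5 : y i ∣ (L : ℤ) := ⟨_, by exact_mod_cast h2⟩
  exact Int.natCast_dvd_natCast.1 (Int.natAbs_dvd.2 h5)

theorem card_filter_dvd_linear_le {b c : ℤ} (hbc : IsCoprime b c) (N : ℕ) {U : Finset ℕ}
    (hU : ∀ u ∈ U, u < N) (d : ℕ) :
    #{u ∈ U | d ∣ (c * (u : ℕ) + b).natAbs} ≤ N / d + 1 := by
  rw [← card_range (N / d + 1)]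
  refine card_le_card_of_injOn (fun u ↦ u / d) ?_ ?_
  · intro u hu
    have := hU u (mem_filter.1 hu).1
    simp only [coe_range, Set.mem_Iio]
    exact Nat.lt_succ_of_le (Nat.div_le_div_right this.le)
  · intro u hu v hv huv
    have hu' := Int.natCast_dvd.2 (mem_filter.1 hu).2
    have hv' := Int.natCast_dvd.2 (mem_filter.1 hv).2
    have hcop : IsCoprime (d : ℤ) c := by
      obtain ⟨r, s, hrs⟩ := hbc
      obtain ⟨k, hk⟩ := hu'
      exact ⟨r * k, s - r * u, by linear_combination hrs - r * hk⟩
    have h1 : (d : ℤ) ∣ (u : ℤ) - v := by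
      apply hcop.dvd_of_dvd_mul_left
      have := dvd_sub hu' hv'
      have e : c * (u : ℤ) + b - (c * v + b) = c * (u - v) := by ring
      rwa [e] at this
    have h2 : v ≡ u [MOD d] := (Nat.modEq_iff_dvd).2 h1
    have h3 : u / d = v / d := huv
    rw [← Nat.div_add_mod u d, ← Nat.div_add_mod v d, h3, h2]

theorem sum_min_gcd_linear_le {b c : ℤ} (hbc : IsCoprime b c) (N : ℕ) {U : Finset ℕ}
    (hU : ∀ u ∈ U, u < N) {L D : ℕ} (hL : L ≠ 0) (hD : #L.divisors ≤ D) :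
    ∑ u ∈ U, min (Nat.gcd (c * (u : ℕ) + b).natAbs L) N ≤ 2 * N * D := by
  calc ∑ u ∈ U, min (Nat.gcd (c * (u : ℕ) + b).natAbs L) N
      ≤ ∑ u ∈ U, ∑ d ∈ L.divisors with d ∣ (c * (u : ℕ) + b).natAbs, min d N :=
        sum_le_sum fun u _ ↦ single_le_sum (f := fun d ↦ min d N) (fun _ _ ↦ Nat.zero_le _)
          (mem_filter.2 ⟨Nat.mem_divisors.2 ⟨Nat.gcd_dvd_right _ _, hL⟩, Nat.gcd_dvd_left _ _⟩)
    _ = ∑ d ∈ L.divisors, #{u ∈ U | d ∣ (c * (u : ℕ) + b).natAbs} * min d N := by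
        simp_rw [sum_filter]
        rw [sum_comm]
        refine sum_congr rfl fun d _ ↦ ?_
        rw [← sum_filter, sum_const, smul_eq_mul]
    _ ≤ ∑ d ∈ L.divisors, 2 * N := by
        refine sum_le_sum fun d _ ↦ ?_
        refine (Nat.mul_le_mul_right _ (card_filter_dvd_linear_le hbc N hU d)).trans ?_
        rcases le_or_gt d N with h | h
        · rw [min_eq_left h, add_mul, one_mul]
          have := Nat.div_mul_le_self N d
          omega
        · rw [min_eq_right h.le, Nat.div_eq_of_lt h]
          omega
    _ = #L.divisors * (2 * N) := by rw [sum_const, smul_eq_mul]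
    _ ≤ 2 * N * D := by rw [mul_comm]; gcongr

theorem min_le_mul_min (m N x y z : ℕ) (h : m ≤ x * y * z) :
    min m N ≤ min x N * min y N * min z N := by
  rcases Nat.eq_zero_or_pos m with rfl | hm
  · simp
  rcases Nat.eq_zero_or_pos N with rfl | hN
  · simp
  have hx : 0 < x := Nat.pos_of_ne_zero (by rintro rfl; simp at h; omega)
  have hy : 0 < y := Nat.pos_of_ne_zero (by rintro rfl; simp at h; omega)
  have hz : 0 < z := Nat.pos_of_ne_zero (by rintro rfl; simp at h; omega)
  have hx' : 1 ≤ min x N := le_min hx hN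
  have hy' : 1 ≤ min y N := le_min hy hN
  have hz' : 1 ≤ min z N := le_min hz hN
  have hxy' : 1 ≤ min x N * min y N := Nat.mul_pos hx' hy'
  rcases le_or_gt x N with h1 | h1
  · rcases le_or_gt y N with h2 | h2
    · rcases le_or_gt z N with h3 | h3
      · rw [min_eq_left h1, min_eq_left h2, min_eq_left h3]
        exact (min_le_left _ _).trans h
      · rw [min_eq_right h3.le]
        exact (min_le_right _ _).trans (Nat.le_mul_of_pos_left _ hxy')
    · refine (min_le_right m N).trans ?_
      calc N = 1 * N * 1 := by ring
        _ ≤ _ := by rw [min_eq_right h2.le]; gcongr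
  · refine (min_le_right m N).trans ?_
    calc N = N * 1 * 1 := by ring
      _ ≤ _ := by rw [min_eq_right h1.le]; gcongr

theorem le_gcd_mul_gcd_mul_gcd {n x y z : ℕ} (hx : x ≠ 0) (hy : y ≠ 0) (hz : z ≠ 0)
    (h : Nat.lcm (Nat.lcm (Nat.lcm n x) y) z ≤ x * y * z) :
    n ≤ Nat.gcd x n * Nat.gcd y (Nat.lcm n x) * Nat.gcd z (Nat.lcm (Nat.lcm n x) y) := by
  have h1 := Nat.gcd_mul_lcm x n
  have h2 := Nat.gcd_mul_lcm y (Nat.lcm n x)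
  have h3 := Nat.gcd_mul_lcm z (Nat.lcm (Nat.lcm n x) y)
  rw [Nat.lcm_comm x] at h1
  rw [Nat.lcm_comm y] at h2
  rw [Nat.lcm_comm z] at h3
  have hpos : 0 < x * y * z := by positivity
  refine Nat.le_of_mul_le_mul_right ?_ hpos
  calc n * (x * y * z) = z * (y * (x * n)) := by ring
    _ = Nat.gcd x n * Nat.gcd y (Nat.lcm n x) * Nat.gcd z (Nat.lcm (Nat.lcm n x) y) *
        Nat.lcm (Nat.lcm (Nat.lcm n x) y) z := by
      rw [← h1, mul_left_comm y, ← h2, mul_left_comm z, mul_left_comm z, ← h3]; ring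
    _ ≤ _ := by gcongr

/-- The number of triples whose members have large common factors with each other and with a
given integer. -/
theorem card_lcm_le_mul_min_le {b c : ℤ} (hbc : IsCoprime b c) (N : ℕ) {U : Finset ℕ}
    (hU : ∀ u ∈ U, u < N) {x : ℕ → ℕ} (hx : ∀ u, x u = (c * (u : ℕ) + b).natAbs)
    (hne : ∀ u ∈ U, x u ≠ 0) {K D : ℕ} (hK : ∀ u ∈ U, x u ≤ K)
    (hD : ∀ n : ℕ, n ≠ 0 → n ≤ K ^ 3 → #n.divisors ≤ D) {u : ℕ} (hu : u ∈ U) :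
    #{v ∈ U ×ˢ U ×ˢ U | Nat.lcm (Nat.lcm (Nat.lcm (x u) (x v.1)) (x v.2.1)) (x v.2.2) ≤
      x v.1 * x v.2.1 * x v.2.2} * min (x u) N ≤ (2 * N * D) ^ 3 := by
  have hK1 : 1 ≤ K := (Nat.one_le_iff_ne_zero.2 (hne u hu)).trans (hK u hu)
  have hD1 : #(x u).divisors ≤ D :=
    hD _ (hne u hu) ((hK u hu).trans (Nat.le_self_pow (by norm_num) K))
  have hD2 : ∀ v ∈ U, #(Nat.lcm (x u) (x v)).divisors ≤ D := fun v hv ↦ by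
    refine hD _ (Nat.lcm_ne_zero (hne u hu) (hne v hv)) ?_
    calc Nat.lcm (x u) (x v) ≤ x u * x v := Nat.le_of_dvd
          (Nat.mul_pos (Nat.pos_of_ne_zero (hne u hu)) (Nat.pos_of_ne_zero (hne v hv)))
          (Nat.lcm_dvd_mul _ _)
      _ ≤ K * K * 1 := by rw [mul_one]; exact Nat.mul_le_mul (hK u hu) (hK v hv)
      _ ≤ K * K * K := by gcongr
      _ = K ^ 3 := by ring
  have hD3 : ∀ v ∈ U, ∀ w ∈ U, #(Nat.lcm (Nat.lcm (x u) (x v)) (x w)).divisors ≤ D :=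
    fun v hv w hw ↦ by
    refine hD _ (Nat.lcm_ne_zero (Nat.lcm_ne_zero (hne u hu) (hne v hv)) (hne w hw)) ?_
    calc Nat.lcm (Nat.lcm (x u) (x v)) (x w) ≤ x u * x v * x w := Nat.le_of_dvd
          (Nat.mul_pos (Nat.mul_pos (Nat.pos_of_ne_zero (hne u hu))
            (Nat.pos_of_ne_zero (hne v hv))) (Nat.pos_of_ne_zero (hne w hw)))
          (Nat.lcm_dvd (Nat.lcm_dvd (dvd_mul_of_dvd_left (dvd_mul_right _ _) _)
            (dvd_mul_of_dvd_left (dvd_mul_left _ _) _)) (dvd_mul_left _ _))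
      _ ≤ K * K * K := Nat.mul_le_mul (Nat.mul_le_mul (hK u hu) (hK v hv)) (hK w hw)
      _ = K ^ 3 := by ring
  let F := fun v : ℕ × ℕ × ℕ ↦ min (Nat.gcd (x v.1) (x u)) N *
    min (Nat.gcd (x v.2.1) (Nat.lcm (x u) (x v.1))) N *
    min (Nat.gcd (x v.2.2) (Nat.lcm (Nat.lcm (x u) (x v.1)) (x v.2.1))) N
  calc _ = ∑ v ∈ U ×ˢ U ×ˢ U with Nat.lcm (Nat.lcm (Nat.lcm (x u) (x v.1)) (x v.2.1)) (x v.2.2) ≤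
      x v.1 * x v.2.1 * x v.2.2, min (x u) N := by rw [sum_const, smul_eq_mul]
    _ ≤ ∑ v ∈ U ×ˢ U ×ˢ U with Nat.lcm (Nat.lcm (Nat.lcm (x u) (x v.1)) (x v.2.1)) (x v.2.2) ≤
      x v.1 * x v.2.1 * x v.2.2, F v := by
        refine sum_le_sum fun v hv ↦ ?_
        simp only [mem_filter, mem_product] at hv
        obtain ⟨⟨h1, h2, h3⟩, h4⟩ := hv
        exact min_le_mul_min _ _ _ _ _
          (le_gcd_mul_gcd_mul_gcd (hne _ h1) (hne _ h2) (hne _ h3) h4)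
    _ ≤ ∑ v ∈ U ×ˢ U ×ˢ U, F v := sum_le_sum_of_subset (filter_subset _ _)
    _ = ∑ v₁ ∈ U, min (Nat.gcd (x v₁) (x u)) N * ∑ v₂ ∈ U,
        min (Nat.gcd (x v₂) (Nat.lcm (x u) (x v₁))) N * ∑ v₃ ∈ U,
          min (Nat.gcd (x v₃) (Nat.lcm (Nat.lcm (x u) (x v₁)) (x v₂))) N := by
        simp only [sum_product, mul_sum, F, mul_assoc]
    _ ≤ ∑ v₁ ∈ U, min (Nat.gcd (x v₁) (x u)) N * ∑ v₂ ∈ U,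
        min (Nat.gcd (x v₂) (Nat.lcm (x u) (x v₁))) N * (2 * N * D) := by
        gcongr with v hv w hw
        simp only [hx] at *
        exact sum_min_gcd_linear_le hbc N hU
          (Nat.lcm_ne_zero (Nat.lcm_ne_zero (hne u hu) (hne v hv)) (hne w hw)) (hD3 v hv w hw)
    _ ≤ ∑ v₁ ∈ U, min (Nat.gcd (x v₁) (x u)) N * ((2 * N * D) * (2 * N * D)) := by
        gcongr with v hv
        rw [← sum_mul]
        gcongr
        simp only [hx] at *
        exact sum_min_gcd_linear_le hbc N hU (Nat.lcm_ne_zero (hne u hu) (hne v hv)) (hD2 v hv)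
    _ ≤ (2 * N * D) * ((2 * N * D) * (2 * N * D)) := by
        rw [← sum_mul]
        gcongr
        simp only [hx] at *
        exact sum_min_gcd_linear_le hbc N hU (hne u hu) hD1
    _ = _ := by ring

/-- The lcm of four of six nonzero integers with vanishing reciprocal sum is small. -/
theorem lcm_le_or_lcm_le {y₁ y₂ y₃ z₁ z₂ z₃ : ℤ} (hy₁ : y₁ ≠ 0) (hy₂ : y₂ ≠ 0) (hy₃ : y₃ ≠ 0)
    (hz₁ : z₁ ≠ 0) (hz₂ : z₂ ≠ 0) (hz₃ : z₃ ≠ 0)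
    (h : esymmTwo y₁ y₂ y₃ * esymmThree z₁ z₂ z₃ = esymmTwo z₁ z₂ z₃ * esymmThree y₁ y₂ y₃) :
    Nat.lcm (Nat.lcm (Nat.lcm y₁.natAbs z₁.natAbs) z₂.natAbs) z₃.natAbs ≤
        z₁.natAbs * z₂.natAbs * z₃.natAbs ∨
      Nat.lcm (Nat.lcm (Nat.lcm z₁.natAbs y₁.natAbs) y₂.natAbs) y₃.natAbs ≤
        y₁.natAbs * y₂.natAbs * y₃.natAbs := by
  let w : Fin 6 → ℤ := ![y₁, y₂, y₃, -z₁, -z₂, -z₃]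
  have hw : ∀ i, w i ≠ 0 := by
    intro i; fin_cases i <;> simp [w, hy₁, hy₂, hy₃, hz₁, hz₂, hz₃]
  have hsum : ∑ i, (1 / (w i : ℚ)) = 0 := by
    have q1 : (y₁ : ℚ) ≠ 0 := by exact_mod_cast hy₁
    have q2 : (y₂ : ℚ) ≠ 0 := by exact_mod_cast hy₂
    have q3 : (y₃ : ℚ) ≠ 0 := by exact_mod_cast hy₃
    have q4 : (z₁ : ℚ) ≠ 0 := by exact_mod_cast hz₁
    have q5 : (z₂ : ℚ) ≠ 0 := by exact_mod_cast hz₂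
    have q6 : (z₃ : ℚ) ≠ 0 := by exact_mod_cast hz₃
    have h' : (esymmTwo y₁ y₂ y₃ * esymmThree z₁ z₂ z₃ : ℚ) =
      esymmTwo z₁ z₂ z₃ * esymmThree y₁ y₂ y₃ := by exact_mod_cast h
    have e1 : 1 / (y₁ : ℚ) + 1 / y₂ + 1 / y₃ =
        (esymmTwo y₁ y₂ y₃ : ℤ) / (esymmThree y₁ y₂ y₃ : ℤ) := by
      simp only [esymmTwo, esymmThree]; push_cast; field_simp; ring
    have e2 : 1 / (z₁ : ℚ) + 1 / z₂ + 1 / z₃ =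
        (esymmTwo z₁ z₂ z₃ : ℤ) / (esymmThree z₁ z₂ z₃ : ℤ) := by
      simp only [esymmTwo, esymmThree]; push_cast; field_simp; ring
    have n1 : ((esymmThree y₁ y₂ y₃ : ℤ) : ℚ) ≠ 0 := by
      simp only [esymmThree]; push_cast; positivity
    have n2 : ((esymmThree z₁ z₂ z₃ : ℤ) : ℚ) ≠ 0 := by
      simp only [esymmThree]; push_cast; positivity
    have e3 : 1 / (y₁ : ℚ) + 1 / y₂ + 1 / y₃ = 1 / (z₁ : ℚ) + 1 / z₂ + 1 / z₃ := by
      rw [e1, e2, div_eq_div_iff n1 n2]; exact h'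
    simp only [w, Fin.sum_univ_succ]
    simp
    simp only [one_div] at e3
    linarith
  let n : Fin 6 → ℕ := fun i ↦ (w i).natAbs
  have hn : ∀ i, n i ≠ 0 := fun i ↦ Int.natAbs_ne_zero.2 (hw i)
  have hdvd := lcm_sq_dvd_prod n hn (natAbs_dvd_lcm_erase w hw hsum)
  set L := univ.lcm n with hL
  have hle := Nat.le_of_dvd (Nat.pos_of_ne_zero (prod_ne_zero_iff.2 fun i _ ↦ hn i)) hdvd
  have hprod : ∏ i, n i = (y₁.natAbs * y₂.natAbs * y₃.natAbs) *
      (z₁.natAbs * z₂.natAbs * z₃.natAbs) := by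
    simp [n, w, Fin.prod_univ_succ]; ring
  rw [hprod] at hle
  have hL0 : 0 < L := Nat.pos_of_ne_zero (by rw [hL, Ne, Finset.lcm_eq_zero_iff]; simp [hn])
  have d : ∀ i, n i ∣ L := fun i ↦ Finset.dvd_lcm (mem_univ i)
  have d0 : y₁.natAbs ∣ L := d 0
  have d1 : y₂.natAbs ∣ L := d 1
  have d2 : y₃.natAbs ∣ L := d 2
  have d3 : z₁.natAbs ∣ L := by simpa [n, w] using d 3
  have d4 : z₂.natAbs ∣ L := by simpa [n, w] using d 4
  have d5 : z₃.natAbs ∣ L := by simpa [n, w] using d 5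
  rcases le_or_gt L (z₁.natAbs * z₂.natAbs * z₃.natAbs) with h1 | h1
  · exact Or.inl ((Nat.le_of_dvd hL0
      (Nat.lcm_dvd (Nat.lcm_dvd (Nat.lcm_dvd d0 d3) d4) d5)).trans h1)
  · refine Or.inr ((Nat.le_of_dvd hL0
      (Nat.lcm_dvd (Nat.lcm_dvd (Nat.lcm_dvd d3 d0) d1) d2)).trans ?_)
    by_contra! h2
    nlinarith [Nat.mul_lt_mul'' h2 h1]

namespace IsBlock

variable {p : ℕ} [Fact p.Prime] {a : ZMod p} {N : ℕ} {U : Finset ℕ}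

open Classical in
/-- The number of solutions which satisfy a relation over the rationals. -/
theorem card_sameRatio_le (h : IsBlock p a N U) {D : ℕ}
    (hD : ∀ n : ℕ, n ≠ 0 → n ≤ p ^ 3 → #n.divisors ≤ D) (hH : harmonic p ≤ D) {A B : ℤ}
    (hA : (A : ZMod p) ≠ 0) (hB : (B : ZMod p) = 2 * a * A) (bA : |A| ≤ 144 * (N : ℤ) ^ 8)
    (bB : |B| ≤ 1008 * (N : ℤ) ^ 9) :
    #{q ∈ (U ×ˢ U ×ˢ U) ×ˢ (U ×ˢ U ×ˢ U) | recipSum a q.1 = recipSum a q.2 ∧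
      SameRatio A B q.1 q.2} ≤ 192 * N ^ 3 * D ^ 5 := by
  have hD1 : 1 ≤ D := by
    simpa using hD 1 one_ne_zero (Nat.one_le_pow _ _ (Fact.out : p.Prime).pos)
  rcases U.eq_empty_or_nonempty with rfl | ⟨u₀, hu₀⟩
  · simp
  have h2 := h.two_ne_zero hu₀
  have hA0 : A ≠ 0 := by rintro rfl; simp at hA
  have hg : 0 < Int.gcd (2 * A) B := Int.gcd_pos_of_ne_zero_left _ (by omega)
  obtain ⟨g, c, b, hg0, hbc, hc, hb⟩ : ∃ g c b : ℤ, g ≠ 0 ∧ IsCoprime b c ∧ 2 * A = g * c ∧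
      B = g * b := by
    obtain ⟨c, b, h1, h2, h3⟩ := Int.exists_gcd_one hg
    refine ⟨Int.gcd (2 * A) B, c, b, by exact_mod_cast hg.ne',
      (Int.isCoprime_iff_gcd_eq_one.2 h1).symm, by linear_combination h2, by linear_combination h3⟩
  have hc0 : c ≠ 0 := by rintro rfl; omega
  have hX : ∀ u : ℕ, 2 * A * (u : ℤ) + B = g * (c * u + b) := fun u ↦ by
    rw [hc, hb]; ring
  have hX' : ∀ u : ℕ, ((2 * A * (u : ℤ) + B : ℤ) : ZMod p) = 2 * A * (a + u) := fun u ↦ by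
    push_cast; rw [hB]; ring
  have hne' : ∀ u ∈ U, c * (u : ℤ) + b ≠ 0 := by
    intro u hu h0
    have := hX' u
    rw [hX, h0, mul_zero, Int.cast_zero] at this
    exact mul_ne_zero (mul_ne_zero h2 hA) (h.ne_zero u hu) this.symm
  obtain ⟨x, hx⟩ : ∃ x : ℕ → ℕ, ∀ u, x u = (c * (u : ℕ) + b).natAbs := ⟨_, fun _ ↦ rfl⟩
  have hne : ∀ u ∈ U, x u ≠ 0 := fun u hu ↦ by
    rw [hx]; exact Int.natAbs_ne_zero.2 (hne' u hu)
  have hxp : ∀ u ∈ U, x u ≤ p := by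
    intro u hu
    have h1 : |2 * A * (u : ℤ) + B| ≤ (2 * 144 * 1 + 1008) * (N : ℤ) ^ 9 := by
      refine abs_add_le_pow (abs_mul_le_pow (i := 8) (j := 1) ?_ ?_) bB
      · rw [abs_mul, show |(2 : ℤ)| = 2 from rfl]; linarith
      · have := h.lt u hu
        rw [abs_of_nonneg (by positivity), pow_one]; omega
    have h3 := h1.trans_lt (h.mul_pow_lt hu₀ (by norm_num) (by norm_num))
    rw [hX, abs_mul] at h3
    have h4 : 1 ≤ |g| := Int.one_le_abs hg0
    have h5 : |c * (u : ℤ) + b| ≤ p := by nlinarith [abs_nonneg (c * (u : ℤ) + b)]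
    rw [hx]
    rw [Int.abs_eq_natAbs] at h5
    exact_mod_cast h5
  have hinj : Set.InjOn x U := by
    intro u hu v hv huv
    rw [hx, hx, Int.natAbs_eq_natAbs_iff] at huv
    rcases huv with h1 | h1
    · have : c * ((u : ℤ) - v) = 0 := by linear_combination h1
      have := (mul_eq_zero.1 this).resolve_left hc0
      omega
    · exfalso
      have e1 := hX' u
      have e2 := hX' v
      rw [hX] at e1 e2
      rw [h1] at e1
      apply h.add_ne_zero u hu v hv
      apply mul_left_cancel₀ (mul_ne_zero h2 hA)
      push_cast at e1 e2
      linear_combination -e1 - e2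
  have hU : #U ≤ N := by
    rw [← card_range N]
    exact card_le_card fun u hu ↦ mem_range.2 (h.lt u hu)
  have hN : 0 < N := (Nat.zero_le _).trans_lt (h.lt _ hu₀)
  let R := fun (u : ℕ) (v : ℕ × ℕ × ℕ) ↦ Nat.lcm (Nat.lcm (Nat.lcm (x u) (x v.1)) (x v.2.1))
    (x v.2.2) ≤ x v.1 * x v.2.1 * x v.2.2
  set Q := {q ∈ U ×ˢ (U ×ˢ U ×ˢ U) | R q.1 q.2} with hQ
  have hQcard : #Q ≤ 16 * N ^ 3 * D ^ 4 := by
    have e1 : #Q = ∑ u ∈ U, #{v ∈ U ×ˢ U ×ˢ U | R u v} := by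
      rw [hQ, card_filter, sum_product]
      refine sum_congr rfl fun u _ ↦ ?_
      rw [card_filter]
    have e2 : ∀ u ∈ U, (#{v ∈ U ×ˢ U ×ˢ U | R u v} : ℚ) ≤
        (2 * N * D) ^ 3 * ((x u : ℚ)⁻¹ + (N : ℚ)⁻¹) := by
      intro u hu
      have h1 := card_lcm_le_mul_min_le hbc N h.lt hx hne hxp hD hu
      have h1' : (#{v ∈ U ×ˢ U ×ˢ U | R u v} : ℚ) * (min (x u) N : ℕ) ≤ (2 * N * D) ^ 3 := by
        exact_mod_cast h1
      have hxu : 0 < (x u : ℚ) := by exact_mod_cast Nat.pos_of_ne_zero (hne u hu)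
      have hN' : 0 < (N : ℚ) := by exact_mod_cast hN
      have hm : 0 < ((min (x u) N : ℕ) : ℚ) := by push_cast; exact lt_min hxu hN'
      calc (#{v ∈ U ×ˢ U ×ˢ U | R u v} : ℚ) ≤ (2 * N * D) ^ 3 / (min (x u) N : ℕ) :=
            (le_div_iff₀ hm).2 h1'
        _ = (2 * N * D) ^ 3 * ((min (x u) N : ℕ) : ℚ)⁻¹ := div_eq_mul_inv _ _
        _ ≤ _ := by
          gcongr
          rcases min_choice (x u) N with h3 | h3 <;> rw [h3]
          · exact le_add_of_nonneg_right (by positivity)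
          · exact le_add_of_nonneg_left (by positivity)
    have e3 : ∑ u ∈ U, (x u : ℚ)⁻¹ ≤ D := by
      refine le_trans ?_ hH
      rw [harmonic_eq_sum_Icc]
      calc ∑ u ∈ U, (x u : ℚ)⁻¹ = ∑ m ∈ U.image x, (m : ℚ)⁻¹ :=
            (sum_image (f := fun m : ℕ ↦ (m : ℚ)⁻¹) hinj).symm
        _ ≤ _ := by
          refine sum_le_sum_of_subset_of_nonneg ?_ fun _ _ _ ↦ by positivity
          intro m hm
          obtain ⟨u, hu, rfl⟩ := mem_image.1 hm
          exact mem_Icc.2 ⟨Nat.pos_of_ne_zero (hne u hu), hxp u hu⟩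
    have e4 : ∑ u ∈ U, (N : ℚ)⁻¹ ≤ 1 := by
      rw [sum_const, nsmul_eq_mul]
      have hN' : 0 < (N : ℚ) := by exact_mod_cast hN
      rw [← div_eq_mul_inv, div_le_one hN']
      exact_mod_cast hU
    have e5 : (#Q : ℚ) ≤ 16 * N ^ 3 * D ^ 4 := by
      have hD' : (1 : ℚ) ≤ D := by exact_mod_cast hD1
      calc (#Q : ℚ) = ∑ u ∈ U, (#{v ∈ U ×ˢ U ×ˢ U | R u v} : ℚ) := by rw [e1]; push_cast; rfl
        _ ≤ ∑ u ∈ U, (2 * N * D) ^ 3 * ((x u : ℚ)⁻¹ + (N : ℚ)⁻¹) := sum_le_sum e2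
        _ = (2 * N * D) ^ 3 * (∑ u ∈ U, (x u : ℚ)⁻¹ + ∑ u ∈ U, (N : ℚ)⁻¹) := by
          rw [← mul_sum, sum_add_distrib]
        _ ≤ (2 * N * D) ^ 3 * (D + D) := by gcongr; exact e4.trans hD'
        _ = _ := by ring
    exact_mod_cast e5
  set T := U ×ˢ U ×ˢ U with hT
  set E := {q ∈ T ×ˢ T | recipSum a q.1 = recipSum a q.2 ∧ R q.1.1 q.2} with hE
  set E' := {q ∈ T ×ˢ T | recipSum a q.1 = recipSum a q.2 ∧ R q.2.1 q.1} with hE'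
  have hEcard : #E ≤ 6 * D * #Q := by
    refine card_le_mul_card_image_of_maps_to (f := fun q ↦ (q.1.1, q.2)) ?_ _ ?_
    · intro q hq
      simp only [hE, mem_filter, mem_product, hT] at hq
      simp only [hQ, hT, mem_filter, mem_product]
      exact ⟨⟨hq.1.1.1, hq.1.2⟩, hq.2.2⟩
    · rintro ⟨u, v⟩ -
      refine (card_le_card_of_injOn Prod.fst ?_ ?_).trans
        (h.card_coord_le hD (recipSum a v) u).1
      · intro q hq
        simp only [coe_filter, Set.mem_ofPred_eq, hE, hT, mem_filter, mem_product,
          Prod.mk.injEq] at hq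
        obtain ⟨⟨⟨h3, -⟩, h4, -⟩, h5, h6⟩ := hq
        simp only [coe_filter, Set.mem_ofPred_eq, mem_recipSols]
        exact ⟨⟨h3, by rw [h4, h6]⟩, h5⟩
      · intro q hq r hr hqr
        have e1 := (mem_filter.1 hq).2
        have e2 := (mem_filter.1 hr).2
        simp only [Prod.mk.injEq] at e1 e2
        exact Prod.ext hqr (e1.2.trans e2.2.symm)
  have hE'card : #E' ≤ #E := by
    refine card_le_card_of_injOn Prod.swap ?_ Prod.swap_injective.injOn
    intro q hq
    simp only [coe_filter, Set.mem_ofPred_eq, hE', mem_product] at hq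
    simp only [coe_filter, Set.mem_ofPred_eq, hE, mem_product, Prod.fst_swap, Prod.snd_swap]
    exact ⟨⟨hq.1.2, hq.1.1⟩, hq.2.1.symm, hq.2.2⟩
  have hsub : {q ∈ T ×ˢ T | recipSum a q.1 = recipSum a q.2 ∧ SameRatio A B q.1 q.2} ⊆ E ∪ E' := by
    intro q hq
    simp only [mem_filter] at hq
    obtain ⟨hq1, hq2, hq3⟩ := hq
    simp only [hE, hE', mem_union, mem_filter, hq1, hq2, true_and]
    simp only [mem_product, hT] at hq1
    obtain ⟨⟨i1, i2, i3⟩, j1, j2, j3⟩ := hq1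
    simp only [R, hx]
    apply lcm_le_or_lcm_le (hne' _ i1) (hne' _ i2) (hne' _ i3) (hne' _ j1) (hne' _ j2) (hne' _ j3)
    unfold SameRatio at hq3
    simp only [hX] at hq3
    apply mul_left_cancel₀ (pow_ne_zero 5 hg0)
    simp only [esymmTwo, esymmThree] at hq3 ⊢
    linear_combination hq3
  calc _ ≤ #(E ∪ E') := card_le_card hsub
    _ ≤ #E + #E' := card_union_le _ _
    _ ≤ 2 * (6 * D * (16 * N ^ 3 * D ^ 4)) := by
      have := hEcard.trans (Nat.mul_le_mul_left _ hQcard)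
      omega
    _ = _ := by ring

/-- The additive energy of the threefold sums of reciprocals of a block. -/
theorem card_recipSum_eq_le (h : IsBlock p a N U) {D : ℕ}
    (hD : ∀ n : ℕ, n ≠ 0 → n ≤ p ^ 3 → #n.divisors ≤ D) (hH : harmonic p ≤ D) :
    #{q ∈ (U ×ˢ U ×ˢ U) ×ˢ (U ×ˢ U ×ˢ U) | recipSum a q.1 = recipSum a q.2} ≤
      282 * N ^ 3 * D ^ 5 := by
  classical
  have hD1 : 1 ≤ D := by
    simpa using hD 1 one_ne_zero (Nat.one_le_pow _ _ (Fact.out : p.Prime).pos)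
  rcases U.eq_empty_or_nonempty with rfl | ⟨u₀, hu₀⟩
  · simp
  have hU : #U ≤ N := by
    rw [← card_range N]
    exact card_le_card fun u hu ↦ mem_range.2 (h.lt u hu)
  have hN : 0 < N := (Nat.zero_le _).trans_lt (h.lt _ hu₀)
  set T := U ×ˢ U ×ˢ U with hT
  have hTcard : #T ≤ N ^ 3 := by
    rw [hT, card_product, card_product]
    calc #U * (#U * #U) ≤ N * (N * N) := by gcongr
      _ = N ^ 3 := by ring
  obtain ⟨P, hP, hl⟩ : ∃ P : ℕ × ℕ × ℕ → ℕ × ℕ × ℕ → Prop,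
      #{q ∈ T ×ˢ T | recipSum a q.1 = recipSum a q.2 ∧ P q.1 q.2} ≤ 192 * N ^ 3 * D ^ 5 ∧
      ∀ l : ZMod p, l ≠ 0 → #(recipSols a U l) ≤ 54 * D ^ 2 ∨
        ∀ s ∈ recipSols a U l, ∀ t ∈ recipSols a U l, P s t := by
    rcases h.card_recipSols_le_or hD with h1 | ⟨A, B, hA, hB, bA, bB, hl⟩
    · exact ⟨fun _ _ ↦ False, by simp, fun l hl ↦ Or.inl (h1 l hl)⟩
    · exact ⟨SameRatio A B, h.card_sameRatio_le hD hH hA hB bA bB, hl⟩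
  set E := {q ∈ T ×ˢ T | recipSum a q.1 = recipSum a q.2 ∧
    #(recipSols a U (recipSum a q.1)) ≤ 54 * D ^ 2} with hE
  have hEcard : #E ≤ 54 * D ^ 2 * #T := by
    refine card_le_mul_card_image_of_maps_to (f := Prod.fst) ?_ _ ?_
    · intro q hq
      exact (mem_product.1 (mem_filter.1 hq).1).1
    · intro s _
      by_cases hs : #(recipSols a U (recipSum a s)) ≤ 54 * D ^ 2
      · refine (card_le_card_of_injOn Prod.snd ?_ ?_).trans hs
        · intro q hq
          obtain ⟨hqE, rfl⟩ := mem_filter.1 hq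
          obtain ⟨hq1, hq2, -⟩ := mem_filter.1 hqE
          exact mem_filter.2 ⟨(mem_product.1 hq1).2, hq2.symm⟩
        · intro q hq r hr hqr
          exact Prod.ext ((mem_filter.1 hq).2.trans (mem_filter.1 hr).2.symm) hqr
      · rw [filter_eq_empty_iff.2, card_empty]
        · exact Nat.zero_le _
        · rintro q hq rfl
          exact hs (mem_filter.1 hq).2.2
  have hsub : {q ∈ T ×ˢ T | recipSum a q.1 = recipSum a q.2} ⊆
      (recipSols a U 0 ×ˢ recipSols a U 0) ∪ (E ∪
        {q ∈ T ×ˢ T | recipSum a q.1 = recipSum a q.2 ∧ P q.1 q.2}) := by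
    intro q hq
    obtain ⟨hq1, hq2⟩ := mem_filter.1 hq
    have m1 : q.1 ∈ recipSols a U (recipSum a q.1) :=
      mem_filter.2 ⟨(mem_product.1 hq1).1, rfl⟩
    have m2 : q.2 ∈ recipSols a U (recipSum a q.1) :=
      mem_filter.2 ⟨(mem_product.1 hq1).2, hq2.symm⟩
    rw [mem_union, mem_union]
    by_cases h0 : recipSum a q.1 = 0
    · rw [h0] at m1 m2
      exact Or.inl (mem_product.2 ⟨m1, m2⟩)
    · rcases hl _ h0 with h1 | h1
      · exact Or.inr (Or.inl (mem_filter.2 ⟨hq1, hq2, h1⟩))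
      · exact Or.inr (Or.inr (mem_filter.2 ⟨hq1, hq2, h1 _ m1 _ m2⟩))
  have h0 := h.card_recipSols_le hD 0
  calc _ ≤ _ := card_le_card hsub
    _ ≤ _ := (card_union_le _ _).trans (Nat.add_le_add_left (card_union_le _ _) _)
    _ ≤ (6 * D * N) * (6 * D * N) * 1 * 1 + (54 * D ^ 2 * N ^ 3 * 1 + 192 * N ^ 3 * D ^ 5) := by
      rw [card_product, mul_one, mul_one, mul_one]
      gcongr
      exact hEcard.trans (Nat.mul_le_mul_left _ hTcard)
    _ ≤ (6 * D * N) * (6 * D * N) * N * D ^ 3 +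
        (54 * D ^ 2 * N ^ 3 * D ^ 3 + 192 * N ^ 3 * D ^ 5) := by
      have : 1 ≤ D ^ 3 := Nat.one_le_pow _ _ hD1
      gcongr
      exact hN
    _ = _ := by ring

end IsBlock

open Polynomial in
/-- A sum of reciprocals of linear polynomials, one of which occurs only once, has few zeros. -/
theorem card_sum_inv_eq_zero_le {p : ℕ} [Fact p.Prime] {J : Type*} [Fintype J] [DecidableEq J]
    (e g : J → ZMod p) {j : J} (he : e j ≠ 0) (hg : ∀ i, i ≠ j → g i ≠ g j) :
    #{ν : ZMod p | ∑ i, e i * (ν + g i)⁻¹ = 0} ≤ 2 * Fintype.card J := by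
  let P : (ZMod p)[X] := ∑ i, C (e i) * ∏ l ∈ univ.erase i, (X + C (g l))
  have hev : ∀ ν, P.eval ν = ∑ i, e i * ∏ l ∈ univ.erase i, (ν + g l) := by
    intro ν
    simp [P, eval_finsetSum, eval_prod]
  have hP : P ≠ 0 := by
    intro h0
    have h1 := hev (-(g j))
    rw [h0, eval_zero, sum_eq_single j] at h1
    · refine mul_ne_zero he (prod_ne_zero_iff.2 fun l hl ↦ ?_) h1.symm
      rw [neg_add_eq_sub]
      exact sub_ne_zero.2 (hg l (ne_of_mem_erase hl))
    · intro i _ hij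
      rw [prod_eq_zero (mem_erase.2 ⟨hij.symm, mem_univ j⟩) (neg_add_cancel _), mul_zero]
    · simp
  have hdeg : P.natDegree ≤ Fintype.card J := by
    refine natDegree_sum_le_of_forall_le _ _ fun i _ ↦ ?_
    refine (natDegree_C_mul_le _ _).trans ((natDegree_prod_le _ _).trans ?_)
    refine (sum_le_card_nsmul _ _ 1 fun l _ ↦ (natDegree_X_add_C _).le).trans ?_
    rw [smul_eq_mul, mul_one]
    exact card_le_univ _
  have hsub : ({ν : ZMod p | ∑ i, e i * (ν + g i)⁻¹ = 0} : Finset (ZMod p)) ⊆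
      (univ.image fun i ↦ -(g i)) ∪ P.roots.toFinset := by
    intro ν hν
    rw [mem_filter] at hν
    rw [mem_union, or_iff_not_imp_left]
    intro hn
    have hne : ∀ i, ν + g i ≠ 0 := fun i h0 ↦
      hn (mem_image.2 ⟨i, mem_univ i, (eq_neg_of_add_eq_zero_left h0).symm⟩)
    rw [Multiset.mem_toFinset, mem_roots hP, IsRoot, hev]
    calc ∑ i, e i * ∏ l ∈ univ.erase i, (ν + g l)
        = ∑ i, (∏ l, (ν + g l)) * (e i * (ν + g i)⁻¹) := by
          refine sum_congr rfl fun i _ ↦ ?_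
          rw [← mul_prod_erase univ _ (mem_univ i)]
          field_simp [hne i]
      _ = 0 := by rw [← mul_sum, hν.2, mul_zero]
  calc _ ≤ _ := card_le_card hsub
    _ ≤ _ := card_union_le _ _
    _ ≤ Fintype.card J + Fintype.card J := by
      gcongr
      · exact card_image_le
      · exact (Multiset.toFinset_card_le _).trans ((card_roots' P).trans hdeg)
    _ = _ := (two_mul _).symm

/-- The number of functions taking no value exactly once. -/
theorem card_no_unique_value_le {J : Type*} [Fintype J] [DecidableEq J] {k Y : ℕ}
    (hJ : Fintype.card J = 2 * k) (hY : 0 < Y) :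
    #{g ∈ Fintype.piFinset fun _ : J ↦ range Y | ∀ j, ∃ i, i ≠ j ∧ g i = g j} ≤
      k ^ (2 * k) * Y ^ k := by
  have hsub : {g ∈ Fintype.piFinset fun _ : J ↦ range Y | ∀ j, ∃ i, i ≠ j ∧ g i = g j} ⊆
      ((univ : Finset (J → Fin k)) ×ˢ Fintype.piFinset fun _ : Fin k ↦ range Y).image
        fun q ↦ q.2 ∘ q.1 := by
    intro g hg
    obtain ⟨hg1, hg2⟩ := mem_filter.1 hg
    rw [Fintype.mem_piFinset] at hg1
    have hcard : #(univ.image g) ≤ k := by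
      have : 2 * #(univ.image g) ≤ #(univ : Finset J) := by
        refine mul_card_image_le_card _ _ fun b hb ↦ ?_
        obtain ⟨j, -, rfl⟩ := mem_image.1 hb
        obtain ⟨i, hij, hi⟩ := hg2 j
        calc 2 = #{i, j} := (card_pair hij).symm
          _ ≤ _ := card_le_card fun l hl ↦ by
            rcases mem_insert.1 hl with rfl | hl
            · simp [hi]
            · simp [mem_singleton.1 hl]
      rw [card_univ, hJ] at this
      omega
    obtain ⟨e⟩ : Nonempty (univ.image g ↪ Fin k) :=
      Function.Embedding.nonempty_of_card_le (by simpa using hcard)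
    refine mem_image.2 ⟨(fun j ↦ e ⟨g j, mem_image_of_mem g (mem_univ j)⟩,
      Function.extend e Subtype.val fun _ ↦ 0), ?_, ?_⟩
    · refine mem_product.2 ⟨mem_univ _, Fintype.mem_piFinset.2 fun i ↦ ?_⟩
      by_cases hi : ∃ s, e s = i
      · obtain ⟨⟨s, hs⟩, rfl⟩ := hi
        obtain ⟨j, -, rfl⟩ := mem_image.1 hs
        simp only [e.injective.extend_apply]
        exact hg1 j
      · simp only [Function.extend_apply' _ _ _ hi]
        exact mem_range.2 hY
    · funext j
      simp only [Function.comp_apply, e.injective.extend_apply]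
  refine (card_le_card hsub).trans (card_image_le.trans ?_)
  simp [card_product, Fintype.card_piFinset, hJ]

theorem addChar_sum_eq_prod {A M ι : Type*} [AddCommMonoid A] [CommMonoid M] (ψ : AddChar A M)
    (S : Finset ι) (f : ι → A) : ψ (∑ i ∈ S, f i) = ∏ i ∈ S, ψ (f i) := by
  classical
  induction S using Finset.induction_on with
  | empty => simp
  | insert i S hi ih => rw [sum_insert hi, prod_insert hi, AddChar.map_add_eq_mul, ih]

theorem sum_norm_sq_addChar {p : ℕ} [Fact p.Prime] {ι : Type*} (P : Finset ι) (r : ι → ZMod p) :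
    ∑ μ : ZMod p, ‖∑ f ∈ P, (ZMod.stdAddChar (μ * r f) : ℂ)‖ ^ 2 =
      p * #{q ∈ P ×ˢ P | r q.1 = r q.2} := by
  classical
  have h1 : ∀ μ : ZMod p, ((‖∑ f ∈ P, (ZMod.stdAddChar (μ * r f) : ℂ)‖ ^ 2 : ℝ) : ℂ) =
      ∑ q ∈ P ×ˢ P, (ZMod.stdAddChar (μ * (r q.1 - r q.2)) : ℂ) := by
    intro μ
    rw [Complex.ofReal_pow, ← Complex.mul_conj', map_sum, sum_mul_sum, ← sum_product']
    refine sum_congr rfl fun q _ ↦ ?_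
    rw [mul_sub, AddChar.map_sub_eq_div, div_eq_mul_inv]
    congr 1
    rw [← AddChar.map_neg_eq_conj, AddChar.map_neg_eq_inv]
  have h2 : ∀ b : ZMod p, ∑ μ : ZMod p, (ZMod.stdAddChar (μ * b) : ℂ) = if b = 0 then (p : ℂ) else 0 := by
    intro b
    have := AddChar.sum_mulShift b (ZMod.isPrimitive_stdAddChar p)
    rw [this, ZMod.card]
    split_ifs <;> simp
  have h3 : ((∑ μ : ZMod p, ‖∑ f ∈ P, (ZMod.stdAddChar (μ * r f) : ℂ)‖ ^ 2 : ℝ) : ℂ) =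
      ((p * #{q ∈ P ×ˢ P | r q.1 = r q.2} : ℝ) : ℂ) := by
    push_cast
    simp only [← Complex.ofReal_pow]
    rw [sum_congr rfl fun μ _ ↦ h1 μ, sum_comm]
    simp_rw [h2, sub_eq_zero]
    rw [← sum_filter, sum_const, nsmul_eq_mul, mul_comm]
  exact_mod_cast h3

/-- An even moment of short sums of reciprocals. -/
theorem sum_norm_pow_le {p : ℕ} [Fact p.Prime] {k Y : ℕ} (hY : 0 < Y) (hYp : Y ≤ p) :
    ∑ μ : ZMod p, ∑ ν : ZMod p,
      ‖∑ y ∈ range Y, (ZMod.stdAddChar (μ * (ν + (y : ZMod p))⁻¹) : ℂ)‖ ^ (2 * k) ≤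
      (p : ℝ) * (p * (k ^ (2 * k) * Y ^ k) + 4 * k * Y ^ (2 * k)) := by
  classical
  let P := Fintype.piFinset fun _ : Fin k ↦ range Y
  let r : ZMod p → (Fin k → ℕ) → ZMod p := fun ν f ↦ ∑ i, (ν + (f i : ZMod p))⁻¹
  have h1 : ∀ μ ν : ZMod p,
      ‖∑ y ∈ range Y, (ZMod.stdAddChar (μ * (ν + (y : ZMod p))⁻¹) : ℂ)‖ ^ (2 * k) =
        ‖∑ f ∈ P, (ZMod.stdAddChar (μ * r ν f) : ℂ)‖ ^ 2 := by
    intro μ ν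
    rw [mul_comm 2 k, pow_mul, ← norm_pow, sum_pow']
    congr 3 with f
    rw [mul_sum, addChar_sum_eq_prod]
  have h2 : ∀ f f' : Fin k → ℕ, f ∈ P → f' ∈ P →
      (¬ ∀ j, ∃ i, i ≠ j ∧ Sum.elim f f' i = Sum.elim f f' j) →
      #{ν : ZMod p | r ν f = r ν f'} ≤ 4 * k := by
    intro f f' hf hf' hj
    push Not at hj
    obtain ⟨j, hj⟩ := hj
    have hlt : ∀ i, Sum.elim f f' i < Y := by
      rw [Fintype.mem_piFinset] at hf hf'
      rintro (i | i)
      · exact mem_range.1 (hf i)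
      · exact mem_range.1 (hf' i)
    have h3 := card_sum_inv_eq_zero_le (p := p) (Sum.elim (fun _ : Fin k ↦ 1) fun _ : Fin k ↦ -1)
      (fun i ↦ ((Sum.elim f f' i : ℕ) : ZMod p)) (j := j) (by rcases j with j | j <;> simp)
      fun i hi hij ↦ hj i hi (by
        have := (ZMod.natCast_eq_natCast_iff' _ _ _).1 hij
        rwa [Nat.mod_eq_of_lt ((hlt i).trans_le hYp),
          Nat.mod_eq_of_lt ((hlt j).trans_le hYp)] at this)
    calc _ = _ := by
          congr 1
          ext ν
          simp only [mem_filter, mem_univ, true_and, Fintype.sum_sum_type, Sum.elim_inl,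
            Sum.elim_inr, one_mul, neg_mul, sum_neg_distrib, r, ← sub_eq_add_neg, sub_eq_zero]
      _ ≤ _ := h3
      _ = 4 * k := by simp; ring
  let bad : Finset ((Fin k → ℕ) × (Fin k → ℕ)) :=
    {q ∈ P ×ˢ P | ∀ j, ∃ i, i ≠ j ∧ Sum.elim q.1 q.2 i = Sum.elim q.1 q.2 j}
  have hbad : #bad ≤ k ^ (2 * k) * Y ^ k := by
    refine (card_le_card_of_injOn (fun q ↦ Sum.elim q.1 q.2) ?_ ?_).trans
      (card_no_unique_value_le (J := Fin k ⊕ Fin k) (by simp; ring) hY)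
    · intro q hq
      obtain ⟨hq1, hq2⟩ := mem_filter.1 hq
      obtain ⟨hq3, hq4⟩ := mem_product.1 hq1
      rw [Fintype.mem_piFinset] at hq3 hq4
      refine mem_filter.2 ⟨Fintype.mem_piFinset.2 ?_, hq2⟩
      rintro (i | i)
      exacts [hq3 i, hq4 i]
    · intro q _ q' _ hqq
      exact Prod.ext (funext fun i ↦ congrFun hqq (Sum.inl i))
        (funext fun i ↦ congrFun hqq (Sum.inr i))
  have hcount : ∑ ν : ZMod p, #{q ∈ P ×ˢ P | r ν q.1 = r ν q.2} ≤
      k ^ (2 * k) * Y ^ k * p + Y ^ (2 * k) * (4 * k) := by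
    calc ∑ ν : ZMod p, #{q ∈ P ×ˢ P | r ν q.1 = r ν q.2}
        = ∑ q ∈ P ×ˢ P, #{ν : ZMod p | r ν q.1 = r ν q.2} := by
          simp_rw [card_filter]
          exact sum_comm
      _ ≤ ∑ q ∈ P ×ˢ P, ((if q ∈ bad then p else 0) + 4 * k) := by
          refine sum_le_sum fun q hq ↦ ?_
          obtain ⟨hq3, hq4⟩ := mem_product.1 hq
          by_cases hb : q ∈ bad
          · rw [if_pos hb]
            exact le_add_right ((card_le_univ _).trans (ZMod.card p).le)
          · rw [if_neg hb, zero_add]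
            exact h2 _ _ hq3 hq4 fun h ↦ hb (mem_filter.2 ⟨hq, h⟩)
      _ = #bad * p + Y ^ (2 * k) * (4 * k) := by
          rw [sum_add_distrib, ← sum_filter, sum_const, sum_const, smul_eq_mul, smul_eq_mul]
          congr 2
          · congr 1
            ext q
            simp only [mem_filter, bad]
            tauto
          · rw [card_product, Fintype.card_piFinset]
            simp
            ring
      _ ≤ _ := by gcongr
  calc _ = ∑ ν : ZMod p, ∑ μ : ZMod p, ‖∑ f ∈ P, (ZMod.stdAddChar (μ * r ν f) : ℂ)‖ ^ 2 := by
        rw [sum_comm]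
        simp_rw [h1]
    _ = p * ((∑ ν : ZMod p, #{q ∈ P ×ˢ P | r ν q.1 = r ν q.2} : ℕ) : ℝ) := by
        rw [Nat.cast_sum, mul_sum]
        exact sum_congr rfl fun ν _ ↦ sum_norm_sq_addChar P (r ν)
    _ ≤ p * ((k ^ (2 * k) * Y ^ k * p + Y ^ (2 * k) * (4 * k) : ℕ) : ℝ) := by gcongr
    _ = _ := by push_cast; ring

theorem norm_stdAddChar {p : ℕ} [NeZero p] (x : ZMod p) : ‖(ZMod.stdAddChar x : ℂ)‖ = 1 := by
  rw [ZMod.stdAddChar_apply]; exact Circle.norm_coe _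

theorem pow_sum_le_card_pow_mul_sum_pow {ι : Type*} (S : Finset ι) (f : ι → ℝ)
    (hf : ∀ i ∈ S, 0 ≤ f i) (n : ℕ) :
    (∑ i ∈ S, f i) ^ (n + 1) ≤ (#S : ℝ) ^ n * ∑ i ∈ S, f i ^ (n + 1) := by
  rcases S.eq_empty_or_nonempty with rfl | hS
  · simp
  have := pow_sum_div_card_le_sum_pow (s := S) (f := f) hf n
  have hpos : 0 < (#S : ℝ) ^ n := pow_pos (by exact_mod_cast hS.card_pos) n
  rwa [div_le_iff₀' hpos] at this

/-- Raising the inner sum to the sixth power removes its coefficients. -/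
theorem sum_norm_pow_six_le {p : ℕ} [Fact p.Prime] (a b c : ZMod p) (U : Finset ℕ) (M : ℕ)
    (α : ℕ → ℂ) (hα : ∀ u ∈ U, ‖α u‖ ≤ 1) :
    (∑ i ∈ range M, ‖∑ u ∈ U, α u *
        (ZMod.stdAddChar (b * (a + (u : ZMod p))⁻¹ * (c + (i : ZMod p))⁻¹) : ℂ)‖) ^ 6 ≤
      (M : ℝ) ^ 5 * ∑ q ∈ (U ×ˢ U ×ˢ U) ×ˢ (U ×ˢ U ×ˢ U), ‖∑ i ∈ range M,
        (ZMod.stdAddChar (b * (recipSum a q.1 - recipSum a q.2) * (c + (i : ZMod p))⁻¹) : ℂ)‖ := by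
  set T := U ×ˢ U ×ˢ U with hT
  let A : ℕ → ℂ := fun i ↦ ∑ u ∈ U, α u *
    (ZMod.stdAddChar (b * (a + (u : ZMod p))⁻¹ * (c + (i : ZMod p))⁻¹) : ℂ)
  have h1 := pow_sum_le_card_pow_mul_sum_pow (range M) (fun i ↦ ‖A i‖)
    (fun i _ ↦ norm_nonneg _) 5
  rw [card_range] at h1
  refine h1.trans ?_
  gcongr
  let w : ℕ × ℕ × ℕ → ℂ := fun s ↦ α s.1 * (α s.2.1 * α s.2.2)
  have hw : ∀ s ∈ T, ‖w s‖ ≤ 1 := by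
    intro s hs
    simp only [hT, mem_product] at hs
    simp only [w, norm_mul]
    exact mul_le_one₀ (hα _ hs.1) (by positivity)
      (mul_le_one₀ (hα _ hs.2.1) (norm_nonneg _) (hα _ hs.2.2))
  have hcube : ∀ i, A i ^ 3 = ∑ s ∈ T, w s *
      (ZMod.stdAddChar (b * recipSum a s * (c + (i : ZMod p))⁻¹) : ℂ) := by
    intro i
    rw [pow_succ', sq]
    simp only [A]
    rw [sum_mul_sum, sum_mul_sum]
    simp_rw [mul_sum]
    rw [hT, sum_product]
    refine sum_congr rfl fun u _ ↦ ?_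
    rw [sum_product]
    refine sum_congr rfl fun v _ ↦ sum_congr rfl fun z _ ↦ ?_
    simp only [w, recipSum, mul_add, add_mul, AddChar.map_add_eq_mul]
    ring
  have hsix : ∀ i, ((‖A i‖ ^ 6 : ℝ) : ℂ) = ∑ q ∈ T ×ˢ T, (w q.1 * (starRingEnd ℂ) (w q.2)) *
      (ZMod.stdAddChar (b * (recipSum a q.1 - recipSum a q.2) * (c + (i : ZMod p))⁻¹) : ℂ) := by
    intro i
    rw [show (6 : ℕ) = 3 * 2 from rfl, pow_mul, ← norm_pow, Complex.ofReal_pow,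
      ← Complex.mul_conj', hcube, map_sum, sum_mul_sum, ← sum_product']
    refine sum_congr rfl fun q _ ↦ ?_
    rw [mul_sub, sub_mul, sub_eq_add_neg, AddChar.map_add_eq_mul, AddChar.map_neg_eq_conj,
      map_mul (starRingEnd ℂ)]
    ring
  have hsum : ((∑ i ∈ range M, ‖A i‖ ^ 6 : ℝ) : ℂ) = ∑ q ∈ T ×ˢ T,
      (w q.1 * (starRingEnd ℂ) (w q.2)) * ∑ i ∈ range M,
        (ZMod.stdAddChar (b * (recipSum a q.1 - recipSum a q.2) * (c + (i : ZMod p))⁻¹) : ℂ) := by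
    rw [Complex.ofReal_sum]
    simp_rw [hsix, mul_sum]
    exact sum_comm
  calc ∑ i ∈ range M, ‖A i‖ ^ 6 = ‖((∑ i ∈ range M, ‖A i‖ ^ 6 : ℝ) : ℂ)‖ := by
        rw [Complex.norm_real, Real.norm_of_nonneg (by positivity)]
    _ ≤ _ := by
        rw [hsum]
        refine norm_sum_le_of_le _ fun q hq ↦ ?_
        obtain ⟨hq1, hq2⟩ := mem_product.1 hq
        rw [norm_mul, norm_mul, RCLike.norm_conj]
        exact mul_le_of_le_one_left (norm_nonneg _)
          (mul_le_one₀ (hw _ hq1) (norm_nonneg _) (hw _ hq2))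

/-- Shifting the variable by products `y z`. -/
theorem norm_sum_inv_shift_le {p : ℕ} [Fact p.Prime] (l c : ZMod p) (M : ℕ) {Y Z : ℕ}
    (hZ : 2 * Z < p) :
    (Y * Z : ℝ) * ‖∑ i ∈ range M, (ZMod.stdAddChar (l * (c + (i : ZMod p))⁻¹) : ℂ)‖ ≤
      ∑ i ∈ range M, ∑ z ∈ Ioc Z (2 * Z), ‖∑ y ∈ range Y,
        (ZMod.stdAddChar (l * (z : ZMod p)⁻¹ *
          ((c + (i : ZMod p)) * (z : ZMod p)⁻¹ + (y : ZMod p))⁻¹) : ℂ)‖ +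
        4 * (Y * Z : ℝ) ^ 2 := by
  let G : ℕ → ℂ := fun i ↦ (ZMod.stdAddChar (l * (c + (i : ZMod p))⁻¹) : ℂ)
  have hG : ∀ i, ‖G i‖ ≤ 1 := fun i ↦ (norm_stdAddChar _).le
  have hzy : ∀ z ∈ Ioc Z (2 * Z), ∀ y ∈ range Y, ∀ i,
      G (i + y * z) = (ZMod.stdAddChar (l * (z : ZMod p)⁻¹ *
          ((c + (i : ZMod p)) * (z : ZMod p)⁻¹ + (y : ZMod p))⁻¹) : ℂ) := by
    intro z hz y _ i
    rw [mem_Ioc] at hz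
    have hz0 : (z : ZMod p) ≠ 0 := by
      rw [Ne, ZMod.natCast_eq_zero_iff]
      exact Nat.not_dvd_of_pos_of_lt (by omega) (by omega)
    have e : c + ((i + y * z : ℕ) : ZMod p) =
        z * ((c + (i : ZMod p)) * (z : ZMod p)⁻¹ + (y : ZMod p)) := by
      push_cast; field_simp; ring
    simp only [G]
    rw [e, mul_inv, mul_assoc]
  have hone : ∀ z ∈ Ioc Z (2 * Z), (Y : ℝ) * ‖∑ i ∈ range M, G i‖ ≤
      ∑ i ∈ range M, ‖∑ y ∈ range Y, G (i + y * z)‖ + Y * (4 * (Y * Z : ℝ)) := by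
    intro z hz
    have hz' : (z : ℝ) ≤ 2 * Z := by exact_mod_cast (mem_Ioc.1 hz).2
    have e1 : ∀ y ∈ range Y, ∑ i ∈ range M, G i = ∑ i ∈ range M, G (i + y * z) +
        (∑ i ∈ range M, G i - ∑ i ∈ range M, G (i + y * z)) := fun y _ ↦ by ring
    have b : ∀ y ∈ range Y, ‖∑ i ∈ range M, G i - ∑ i ∈ range M, G (i + y * z)‖ ≤
        4 * (Y * Z : ℝ) := by
      intro y hy
      have e2 := sum_range_add G M (y * z)
      have e3 := sum_range_add G (y * z) M
      have e4 : ∑ i ∈ range M, G i - ∑ i ∈ range M, G (i + y * z) = ∑ i ∈ range (y * z), G i -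
          ∑ i ∈ range (y * z), G (M + i) := by
        rw [add_comm (y * z) M, e2] at e3
        simp_rw [add_comm (y * z)] at e3
        linear_combination e3
      have b' : ∀ H : ℕ → ℕ, ‖∑ i ∈ range (y * z), G (H i)‖ ≤ y * z := fun H ↦ by
        simpa using norm_sum_le_of_le (range (y * z)) fun i _ ↦ hG (H i)
      rw [e4]
      have hy' : (y : ℝ) ≤ Y := by exact_mod_cast (mem_range.1 hy).le
      have h5 : (y * z : ℝ) ≤ Y * (2 * Z) := by gcongr
      have := norm_sub_le (∑ i ∈ range (y * z), G i) (∑ i ∈ range (y * z), G (M + i))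
      have h6 : ‖∑ i ∈ range (y * z), G i‖ ≤ y * z := b' id
      have h7 : ‖∑ i ∈ range (y * z), G (M + i)‖ ≤ y * z := b' fun i ↦ M + i
      linarith
    calc (Y : ℝ) * ‖∑ i ∈ range M, G i‖ = ‖∑ y ∈ range Y, ∑ i ∈ range M, G i‖ := by
          rw [sum_const, card_range, nsmul_eq_mul, norm_mul, Complex.norm_natCast]
      _ = ‖∑ i ∈ range M, ∑ y ∈ range Y, G (i + y * z) +
          ∑ y ∈ range Y, (∑ i ∈ range M, G i - ∑ i ∈ range M, G (i + y * z))‖ := by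
          rw [sum_comm (s := range M) (t := range Y), ← sum_add_distrib]
          congr 1
          exact sum_congr rfl e1
      _ ≤ ‖∑ i ∈ range M, ∑ y ∈ range Y, G (i + y * z)‖ +
          ‖∑ y ∈ range Y, (∑ i ∈ range M, G i - ∑ i ∈ range M, G (i + y * z))‖ := norm_add_le _ _
      _ ≤ _ := by
          gcongr
          · exact norm_sum_le _ _
          · simpa using norm_sum_le_of_le (range Y) b
  have hcard : #(Ioc Z (2 * Z)) = Z := by rw [Nat.card_Ioc]; omega
  calc (Y * Z : ℝ) * ‖∑ i ∈ range M, G i‖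
      = ∑ z ∈ Ioc Z (2 * Z), (Y : ℝ) * ‖∑ i ∈ range M, G i‖ := by
        rw [sum_const, hcard, nsmul_eq_mul]; ring
    _ ≤ ∑ z ∈ Ioc Z (2 * Z), (∑ i ∈ range M, ‖∑ y ∈ range Y, G (i + y * z)‖ +
        Y * (4 * (Y * Z : ℝ))) := sum_le_sum hone
    _ = ∑ i ∈ range M, ∑ z ∈ Ioc Z (2 * Z), ‖∑ y ∈ range Y, G (i + y * z)‖ +
        4 * (Y * Z : ℝ) ^ 2 := by
        rw [sum_add_distrib, sum_const, hcard, nsmul_eq_mul, sum_comm]; ring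
    _ = _ := by
        congr 1
        exact sum_congr rfl fun i _ ↦ sum_congr rfl fun z hz ↦ by
          rw [sum_congr rfl fun y hy ↦ hzy z hz y hy i]

/-- Hölder's inequality for a sum over the image of a map. -/
theorem pow_sum_comp_le {ι X : Type*} [Fintype X] [DecidableEq X] (Ω : Finset ι) (Φ : ι → X)
    (F : X → ℝ) (hF : ∀ x, 0 ≤ F x) (k : ℕ) :
    (∑ ω ∈ Ω, F (Φ ω)) ^ (2 * (k + 1)) ≤ (#Ω : ℝ) ^ (2 * k) *
      #{q ∈ Ω ×ˢ Ω | Φ q.1 = Φ q.2} * ∑ x, F x ^ (2 * (k + 1)) := by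
  have h1 := pow_sum_le_card_pow_mul_sum_pow Ω (fun ω ↦ F (Φ ω)) (fun ω _ ↦ hF _) k
  have h2 : ∑ ω ∈ Ω, F (Φ ω) ^ (k + 1) =
      ∑ x, (#{ω ∈ Ω | Φ ω = x} : ℝ) * F x ^ (k + 1) := by
    rw [← sum_fiberwise_of_maps_to (t := univ) (g := Φ) fun _ _ ↦ mem_univ _]
    refine sum_congr rfl fun x _ ↦ ?_
    rw [sum_congr rfl fun ω hω ↦ by rw [(mem_filter.1 hω).2], sum_const, nsmul_eq_mul]
  have h3 : ∑ x, (#{ω ∈ Ω | Φ ω = x} : ℝ) ^ 2 = #{q ∈ Ω ×ˢ Ω | Φ q.1 = Φ q.2} := by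
    have : ∑ x, #{ω ∈ Ω | Φ ω = x} ^ 2 = #{q ∈ Ω ×ˢ Ω | Φ q.1 = Φ q.2} := by
      rw [card_eq_sum_card_fiberwise (f := fun q ↦ Φ q.1) (t := univ) fun _ _ ↦ mem_univ _]
      refine sum_congr rfl fun x _ ↦ ?_
      rw [sq, ← card_product]
      congr 1
      ext q
      simp only [mem_product, mem_filter]
      grind
    exact_mod_cast this
  calc _ = ((∑ ω ∈ Ω, F (Φ ω)) ^ (k + 1)) ^ 2 := by rw [← pow_mul, mul_comm]
    _ ≤ ((#Ω : ℝ) ^ k * ∑ ω ∈ Ω, F (Φ ω) ^ (k + 1)) ^ 2 := by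
        gcongr
        exact pow_nonneg (sum_nonneg fun _ _ ↦ hF _) _
    _ = (#Ω : ℝ) ^ (2 * k) * (∑ x, (#{ω ∈ Ω | Φ ω = x} : ℝ) * F x ^ (k + 1)) ^ 2 := by
        rw [h2]; ring
    _ ≤ (#Ω : ℝ) ^ (2 * k) * ((∑ x, (#{ω ∈ Ω | Φ ω = x} : ℝ) ^ 2) *
        ∑ x, (F x ^ (k + 1)) ^ 2) := by
        gcongr
        exact sum_mul_sq_le_sq_mul_sq _ _ _
    _ = _ := by
        rw [h3, ← mul_assoc]
        congr 2 with x
        rw [← pow_mul, mul_comm]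

/-- The pairs `i, i' < M` for which `c + i` and `c + i'` have the same ratio as `z` and `z'`. -/
theorem mul_card_dilate_eq_le {p : ℕ} [Fact p.Prime] (c : ZMod p) {M Z z z' : ℕ}
    (hMZ : 4 * M * Z < p) (hz : z ∈ Ioc Z (2 * Z)) (hz' : z' ∈ Ioc Z (2 * Z)) :
    Z * #{q ∈ range M ×ˢ range M | (c + (q.1 : ZMod p)) * (z' : ZMod p) =
      (c + (q.2 : ZMod p)) * (z : ZMod p)} ≤ M * z.gcd z' + Z := by
  rw [mem_Ioc] at hz hz'
  set g := z.gcd z' with hg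
  have hg0 : 0 < g := Nat.gcd_pos_of_pos_left _ (by omega)
  obtain ⟨w, hw⟩ : g ∣ z := Nat.gcd_dvd_left _ _
  obtain ⟨w', hw'⟩ : g ∣ z' := Nat.gcd_dvd_right _ _
  have hcop : Nat.Coprime w w' := by
    have := Nat.coprime_div_gcd_div_gcd (m := z) (n := z') hg0
    rwa [← hg, hw, hw', Nat.mul_div_cancel_left _ hg0, Nat.mul_div_cancel_left _ hg0] at this
  have hw0 : 0 < w := Nat.pos_of_ne_zero fun h ↦ by simp [h] at hw; omega
  have key : #{q ∈ range M ×ˢ range M | (c + (q.1 : ZMod p)) * (z' : ZMod p) =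
      (c + (q.2 : ZMod p)) * (z : ZMod p)} ≤ #(range (M / w + 1)) := by
    refine card_le_card_of_injOn (fun q ↦ q.1 / w) (fun q hq ↦ ?_) fun q hq r hr hqr ↦ ?_
    · simp only [coe_filter, mem_product, mem_range, Set.mem_ofPred_eq] at hq
      simp only [coe_range, Set.mem_Iio]
      exact Nat.lt_succ_of_le (Nat.div_le_div_right hq.1.1.le)
    · simp only [coe_filter, mem_product, mem_range, Set.mem_ofPred_eq] at hq hr hqr
      obtain ⟨⟨hq1, hq2⟩, hq3⟩ := hq
      obtain ⟨⟨hr1, hr2⟩, hr3⟩ := hr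
      have hcast : (((q.1 : ℤ) - r.1) * z' - ((q.2 : ℤ) - r.2) * z : ℤ) = 0 := by
        apply Int.eq_zero_of_abs_lt_dvd (m := p)
        · rw [← ZMod.intCast_zmod_eq_zero_iff_dvd]
          push_cast
          linear_combination hq3 - hr3
        · have a1 : |(q.1 : ℤ) - r.1| ≤ M := by rw [abs_le]; omega
          have a2 : |(q.2 : ℤ) - r.2| ≤ M := by rw [abs_le]; omega
          have hb : ∀ x : ℤ, ∀ n : ℕ, |x| ≤ M → n ≤ 2 * Z → |x * n| ≤ M * (2 * Z) := by
            intro x n hx hn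
            rw [abs_mul, Nat.abs_cast]
            have : (n : ℤ) ≤ 2 * Z := by exact_mod_cast hn
            gcongr
          have h4 : (4 * M * Z : ℤ) < p := by exact_mod_cast hMZ
          have := abs_sub (((q.1 : ℤ) - r.1) * z') (((q.2 : ℤ) - r.2) * z)
          linarith [hb _ z' a1 hz'.2, hb _ z a2 hz.2]
      have hdvd : (w : ℤ) ∣ (q.1 : ℤ) - r.1 := by
        have h1 : ((q.1 : ℤ) - r.1) * w' = w * ((q.2 : ℤ) - r.2) := by
          have hg' : (g : ℤ) ≠ 0 := by exact_mod_cast hg0.ne'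
          apply mul_left_cancel₀ hg'
          rw [hw, hw'] at hcast
          push_cast at hcast
          linear_combination hcast
        have hcop' : IsCoprime (w : ℤ) w' := Nat.isCoprime_iff_coprime.2 hcop
        exact hcop'.dvd_of_dvd_mul_right (Dvd.intro _ h1.symm)
      have h1 : q.1 = r.1 := by
        have hm : q.1 % w = r.1 % w := ((Nat.modEq_iff_dvd).2 (by
          rw [← neg_sub]; exact hdvd.neg_right))
        rw [← Nat.div_add_mod q.1 w, ← Nat.div_add_mod r.1 w, hqr, hm]
      refine Prod.ext h1 ?_
      rw [h1, sub_self, zero_mul, zero_sub, neg_eq_zero, mul_eq_zero] at hcast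
      omega
  rw [card_range] at key
  have h1 : Z * (M / w) ≤ M * g := calc
    Z * (M / w) ≤ (g * w) * (M / w) := by gcongr; omega
    _ = g * (w * (M / w)) := by ring
    _ ≤ g * M := by gcongr; exact Nat.mul_div_le _ _
    _ = M * g := mul_comm _ _
  calc _ ≤ Z * (M / w + 1) := by gcongr
    _ ≤ _ := by linarith

theorem sum_gcd_dyadic_le {Z D : ℕ} (hD : ∀ n : ℕ, n ≠ 0 → n ≤ 2 * Z → #n.divisors ≤ D) :
    ∑ z ∈ Ioc Z (2 * Z), ∑ z' ∈ Ioc Z (2 * Z), z.gcd z' ≤ Z * (D * (2 * Z)) := by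
  have hcard : #(Ioc Z (2 * Z)) = Z := by rw [Nat.card_Ioc]; omega
  have hmul : ∀ d, d * #{z' ∈ Ioc Z (2 * Z) | d ∣ z'} ≤ 2 * Z := by
    intro d
    have : #{z' ∈ Ioc Z (2 * Z) | d ∣ z'} ≤ 2 * Z / d := by
      rw [← Nat.Ioc_filter_dvd_card_eq_div]
      refine card_le_card fun x hx ↦ ?_
      simp only [mem_filter, mem_Ioc] at hx ⊢
      exact ⟨⟨by omega, hx.1.2⟩, hx.2⟩
    calc _ ≤ d * (2 * Z / d) := by gcongr
      _ ≤ _ := Nat.mul_div_le _ _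
  have hone : ∀ z ∈ Ioc Z (2 * Z), ∑ z' ∈ Ioc Z (2 * Z), z.gcd z' ≤ D * (2 * Z) := by
    intro z hz
    rw [mem_Ioc] at hz
    calc ∑ z' ∈ Ioc Z (2 * Z), z.gcd z'
        ≤ ∑ z' ∈ Ioc Z (2 * Z), ∑ d ∈ z.divisors, if d ∣ z' then d else 0 := by
          refine sum_le_sum fun z' _ ↦ ?_
          refine le_trans ?_ (single_le_sum (f := fun d ↦ if d ∣ z' then d else 0)
            (fun _ _ ↦ Nat.zero_le _) (Nat.mem_divisors.2 ⟨Nat.gcd_dvd_left z z', by omega⟩))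
          simp [Nat.gcd_dvd_right]
      _ = ∑ d ∈ z.divisors, d * #{z' ∈ Ioc Z (2 * Z) | d ∣ z'} := by
          rw [sum_comm]
          refine sum_congr rfl fun d _ ↦ ?_
          rw [← sum_filter, sum_const, smul_eq_mul, mul_comm]
      _ ≤ ∑ d ∈ z.divisors, 2 * Z := sum_le_sum fun d _ ↦ hmul d
      _ ≤ _ := by
          rw [sum_const, smul_eq_mul]
          gcongr
          exact hD _ (by omega) hz.2
  calc _ ≤ ∑ z ∈ Ioc Z (2 * Z), D * (2 * Z) := sum_le_sum hone
    _ = _ := by rw [sum_const, hcard, smul_eq_mul]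

theorem card_dilate_energy_le {p : ℕ} [Fact p.Prime] (c : ZMod p) {M Z D : ℕ}
    (hMZ : 4 * M * Z < p) (hZ : 0 < Z) (hZM : Z ≤ M)
    (hD : ∀ n : ℕ, n ≠ 0 → n ≤ 2 * Z → #n.divisors ≤ D) :
    #{t ∈ (Ioc Z (2 * Z) ×ˢ Ioc Z (2 * Z)) ×ˢ (range M ×ˢ range M) |
      (c + (t.2.1 : ZMod p)) * (t.1.2 : ZMod p) = (c + (t.2.2 : ZMod p)) * (t.1.1 : ZMod p)} ≤
      3 * (M * Z * D) := by
  have hcard : #(Ioc Z (2 * Z)) = Z := by rw [Nat.card_Ioc]; omega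
  have hD1 : 1 ≤ D := by simpa using hD 1 one_ne_zero (by omega)
  refine le_of_mul_le_mul_left (a := Z) ?_ hZ
  rw [card_filter, sum_product]
  simp_rw [← card_filter]
  rw [mul_sum]
  calc _ ≤ ∑ x ∈ Ioc Z (2 * Z) ×ˢ Ioc Z (2 * Z), (M * x.1.gcd x.2 + Z) := by
        refine sum_le_sum fun x hx ↦ ?_
        obtain ⟨h1, h2⟩ := mem_product.1 hx
        exact mul_card_dilate_eq_le c hMZ h1 h2
    _ = M * (∑ z ∈ Ioc Z (2 * Z), ∑ z' ∈ Ioc Z (2 * Z), z.gcd z') + Z * Z * Z := by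
        rw [sum_add_distrib, ← mul_sum, sum_product, sum_const, card_product, hcard, smul_eq_mul]
    _ ≤ M * (Z * (D * (2 * Z))) + Z * (M * Z) * D := by
        gcongr M * ?_ + ?_
        · exact sum_gcd_dyadic_le hD
        · calc Z * Z * Z = Z * (Z * Z) * 1 := by ring
            _ ≤ _ := by gcongr
    _ = _ := by ring

theorem two_mul_card_eq_le {ι X : Type*} [Fintype X] [DecidableEq X] (S : Finset ι) (f g : ι → X) :
    2 * #{q ∈ S ×ˢ S | f q.1 = g q.2} ≤
      #{q ∈ S ×ˢ S | f q.1 = f q.2} + #{q ∈ S ×ˢ S | g q.1 = g q.2} := by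
  have h : ∀ f g : ι → X, #{q ∈ S ×ˢ S | f q.1 = g q.2} =
      ∑ x, #{s ∈ S | f s = x} * #{s ∈ S | g s = x} := by
    intro f g
    rw [card_eq_sum_card_fiberwise (f := fun q ↦ f q.1) (t := univ) fun _ _ ↦ mem_univ _]
    refine sum_congr rfl fun x _ ↦ ?_
    rw [← card_product]
    congr 1
    ext q
    simp only [mem_product, mem_filter]
    grind
  rw [h, h, h, mul_sum, ← sum_add_distrib]
  refine sum_le_sum fun x _ ↦ ?_
  have := two_mul_le_add_sq #{s ∈ S | f s = x} #{s ∈ S | g s = x}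
  linarith

/-- The multiplicative shift map: its second moment is controlled by additive energies. -/
theorem card_shift_energy_le {p : ℕ} [Fact p.Prime] {ι : Type*} [DecidableEq ι] (b c : ZMod p)
    (hb : b ≠ 0) (T : Finset ι) (r : ι → ZMod p) {M Z D : ℕ}
    (hMZ : 4 * M * Z < p) (hZ : 0 < Z) (hZM : Z ≤ M)
    (hD : ∀ n : ℕ, n ≠ 0 → n ≤ 2 * Z → #n.divisors ≤ D) (Φ : (ι × ι) × ℕ × ℕ → ZMod p × ZMod p)
    (hΦ : ∀ ω, Φ ω = (b * (r ω.1.1 - r ω.1.2) * (ω.2.2 : ZMod p)⁻¹,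
      (c + (ω.2.1 : ZMod p)) * (ω.2.2 : ZMod p)⁻¹)) :
    #{w ∈ ((T ×ˢ T) ×ˢ (range M ×ˢ Ioc Z (2 * Z))) ×ˢ ((T ×ˢ T) ×ˢ (range M ×ˢ Ioc Z (2 * Z))) |
      Φ w.1 = Φ w.2} ≤
      #{q ∈ T ×ˢ T | r q.1 = r q.2} * #(T ×ˢ T) * (3 * (M * Z * D)) := by
  have hz0 : ∀ z ∈ Ioc Z (2 * Z), (z : ZMod p) ≠ 0 := by
    intro z hz
    rw [mem_Ioc] at hz
    have : 4 * 1 * Z ≤ 4 * M * Z := by gcongr; omega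
    rw [Ne, ZMod.natCast_eq_zero_iff]
    exact Nat.not_dvd_of_pos_of_lt (by omega) (by omega)
  refine le_trans ?_ (Nat.mul_le_mul_left _ (card_dilate_energy_le c hMZ hZ hZM hD))
  refine card_le_mul_card_image_of_maps_to
    (f := fun w ↦ ((w.1.2.2, w.2.2.2), (w.1.2.1, w.2.2.1))) (fun w hw ↦ ?_) _ fun x hx ↦ ?_
  · simp only [mem_filter, mem_product, hΦ, Prod.mk.injEq] at hw ⊢
    obtain ⟨⟨⟨_, h1, h2⟩, _, h3, h4⟩, _, h5⟩ := hw
    refine ⟨⟨⟨h2, h4⟩, h1, h3⟩, ?_⟩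
    have := hz0 _ h2
    have := hz0 _ h4
    field_simp at h5
    linear_combination h5
  obtain ⟨⟨z, z'⟩, i, i'⟩ := x
  simp only [mem_filter, mem_product] at hx
  obtain ⟨⟨⟨hz, hz'⟩, _⟩, _⟩ := hx
  have hz := hz0 _ hz
  have hz' := hz0 _ hz'
  refine card_le_mul_card_image_of_maps_to (f := fun w ↦ (w.1.1.2, w.2.1.2))
    (fun w hw ↦ ?_) _ fun y _ ↦ ?_
  · simp only [mem_filter, mem_product] at hw ⊢
    tauto
  obtain ⟨t, t'⟩ := y
  have h1 := two_mul_card_eq_le T (fun s ↦ (r s - r t) * (z' : ZMod p))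
    (fun s ↦ (r s - r t') * (z : ZMod p))
  simp only [mul_eq_mul_right_iff, hz, hz', or_false, sub_left_inj] at h1
  refine le_trans ?_ (show #{q ∈ T ×ˢ T | (r q.1 - r t) * (z' : ZMod p) =
    (r q.2 - r t') * (z : ZMod p)} ≤ _ by omega)
  refine card_le_card_of_injOn (fun w ↦ (w.1.1.1, w.2.1.1)) (fun w hw ↦ ?_) fun w hw v hv h ↦ ?_
  · simp only [coe_filter, mem_filter, mem_product, hΦ, Prod.mk.injEq, Set.mem_ofPred_eq] at hw ⊢
    obtain ⟨⟨⟨h0, h2, _⟩, ⟨rfl, rfl⟩, _⟩, rfl, rfl⟩ := hw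
    refine ⟨⟨h0.1.1.1, h0.2.1.1⟩, ?_⟩
    field_simp at h2
    linear_combination h2
  · simp only [coe_filter, mem_filter, Prod.mk.injEq, Set.mem_ofPred_eq] at hw hv h
    obtain ⟨⟨_, ⟨e1, e2⟩, e3, e4⟩, e5, e6⟩ := hw
    obtain ⟨⟨_, ⟨f1, f2⟩, f3, f4⟩, f5, f6⟩ := hv
    ext <;> simp_all

/-- The bilinear estimate over a block, with all parameters free. -/
theorem IsBlock.sum_norm_pow_six_le {p : ℕ} [Fact p.Prime] {a : ZMod p} {N : ℕ} {U : Finset ℕ}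
    (h : IsBlock p a N U) {b : ZMod p} (hb : b ≠ 0) (c : ZMod p) {M Y Z D k : ℕ}
    (hD : ∀ n : ℕ, n ≠ 0 → n ≤ p ^ 3 → #n.divisors ≤ D) (hH : harmonic p ≤ D)
    (hY : 0 < Y) (hYp : Y ≤ p) (hZ : 0 < Z) (hZM : Z ≤ M) (hMZ : 4 * M * Z < p)
    {Q : ℝ} (hQ : 0 ≤ Q)
    (hQk : 846 * (D : ℝ) ^ 6 * (p * (p * ((k + 1 : ℕ) ^ (2 * (k + 1)) * (Y : ℝ) ^ (k + 1)) +
      4 * (k + 1 : ℕ) * (Y : ℝ) ^ (2 * (k + 1)))) ≤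
      Q ^ (2 * (k + 1)) * (Y : ℝ) ^ (2 * (k + 1)) * N ^ 3 * M * Z)
    (α : ℕ → ℂ) (hα : ∀ u ∈ U, ‖α u‖ ≤ 1) :
    (∑ i ∈ range M, ‖∑ u ∈ U, α u *
        (ZMod.stdAddChar (b * (a + (u : ZMod p))⁻¹ * (c + (i : ZMod p))⁻¹) : ℂ)‖) ^ 6 ≤
      ((M : ℝ) * N) ^ 6 * (Q + 4 * (Y * Z) / M) := by
  have hM : 0 < M := by omega
  have h2Z : 2 * Z < p := by
    have : 4 * 1 * Z ≤ 4 * M * Z := by gcongr; omega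
    omega
  have hUN : #U ≤ N := by
    simpa using card_le_card (t := range N) fun u hu ↦ mem_range.2 (h.lt u hu)
  set T := U ×ˢ U ×ˢ U with hT
  have hTN : #(T ×ˢ T) ≤ N ^ 6 := by
    simp only [hT, card_product]
    calc _ ≤ (N * (N * N)) * (N * (N * N)) := by gcongr
      _ = N ^ 6 := by ring
  let F : ZMod p × ZMod p → ℝ := fun x ↦
    ‖∑ y ∈ range Y, (ZMod.stdAddChar (x.1 * (x.2 + (y : ZMod p))⁻¹) : ℂ)‖
  let Φ : ((ℕ × ℕ × ℕ) × ℕ × ℕ × ℕ) × ℕ × ℕ → ZMod p × ZMod p := fun ω ↦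
    (b * (recipSum a ω.1.1 - recipSum a ω.1.2) * (ω.2.2 : ZMod p)⁻¹,
      (c + (ω.2.1 : ZMod p)) * (ω.2.2 : ZMod p)⁻¹)
  set Ω := (T ×ˢ T) ×ˢ (range M ×ˢ Ioc Z (2 * Z)) with hΩ
  have hΩcard : (#Ω : ℝ) ≤ N ^ 6 * M * Z := by
    have hcard : #(Ioc Z (2 * Z)) = Z := by rw [Nat.card_Ioc]; omega
    have : #Ω ≤ N ^ 6 * (M * Z) := by
      rw [hΩ, card_product (T ×ˢ T), card_product (range M), hcard, card_range]
      gcongr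
    calc (#Ω : ℝ) ≤ ((N ^ 6 * (M * Z) : ℕ) : ℝ) := by exact_mod_cast this
      _ = _ := by push_cast; ring
  set W := ∑ ω ∈ Ω, F (Φ ω) with hW
  have hW0 : 0 ≤ W := sum_nonneg fun _ _ ↦ norm_nonneg _
  have henergy : (#{q ∈ Ω ×ˢ Ω | Φ q.1 = Φ q.2} : ℝ) ≤ 846 * N ^ 9 * M * Z * D ^ 6 := by
    have h1 := card_shift_energy_le b c hb T (recipSum a) hMZ hZ hZM
      (fun n hn hnZ ↦ hD n hn (hnZ.trans (h2Z.le.trans (Nat.le_self_pow (by norm_num) p))))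
      Φ fun _ ↦ rfl
    have h2 := h.card_recipSum_eq_le hD hH
    have h3 : #{q ∈ Ω ×ˢ Ω | Φ q.1 = Φ q.2} ≤
        (282 * N ^ 3 * D ^ 5) * N ^ 6 * (3 * (M * Z * D)) := h1.trans (by gcongr)
    calc (#{q ∈ Ω ×ˢ Ω | Φ q.1 = Φ q.2} : ℝ)
        ≤ (((282 * N ^ 3 * D ^ 5) * N ^ 6 * (3 * (M * Z * D)) : ℕ) : ℝ) := by exact_mod_cast h3
      _ = _ := by push_cast; ring
  have hmom : ∑ x, F x ^ (2 * (k + 1)) ≤ p * (p * ((k + 1 : ℕ) ^ (2 * (k + 1)) *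
      (Y : ℝ) ^ (k + 1)) + 4 * (k + 1 : ℕ) * (Y : ℝ) ^ (2 * (k + 1))) := by
    rw [Fintype.sum_prod_type]
    exact sum_norm_pow_le hY hYp
  have hWQ : W ≤ Q * Y * (N ^ 6 * M * Z) := by
    refine le_of_pow_le_pow_left₀ (n := 2 * (k + 1)) (by omega) (by positivity) ?_
    calc W ^ (2 * (k + 1)) ≤ (#Ω : ℝ) ^ (2 * k) * #{q ∈ Ω ×ˢ Ω | Φ q.1 = Φ q.2} *
          ∑ x, F x ^ (2 * (k + 1)) := pow_sum_comp_le Ω Φ F (fun _ ↦ norm_nonneg _) k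
      _ ≤ (N ^ 6 * M * Z : ℝ) ^ (2 * k) * (846 * N ^ 9 * M * Z * D ^ 6) *
          (p * (p * ((k + 1 : ℕ) ^ (2 * (k + 1)) * (Y : ℝ) ^ (k + 1)) +
            4 * (k + 1 : ℕ) * (Y : ℝ) ^ (2 * (k + 1)))) := by
          gcongr
      _ = (N ^ 6 * M * Z : ℝ) ^ (2 * k) * (N ^ 9 * M * Z) * (846 * (D : ℝ) ^ 6 *
          (p * (p * ((k + 1 : ℕ) ^ (2 * (k + 1)) * (Y : ℝ) ^ (k + 1)) +
            4 * (k + 1 : ℕ) * (Y : ℝ) ^ (2 * (k + 1))))) := by ring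
      _ ≤ (N ^ 6 * M * Z : ℝ) ^ (2 * k) * (N ^ 9 * M * Z) *
          (Q ^ (2 * (k + 1)) * (Y : ℝ) ^ (2 * (k + 1)) * N ^ 3 * M * Z) := by gcongr
      _ = _ := by ring
  set X := ∑ i ∈ range M, ‖∑ u ∈ U, α u *
        (ZMod.stdAddChar (b * (a + (u : ZMod p))⁻¹ * (c + (i : ZMod p))⁻¹) : ℂ)‖
  have hYZ : (0 : ℝ) < Y * Z := by positivity
  have hmain : (Y * Z : ℝ) * X ^ 6 ≤ M ^ 5 * (W + N ^ 6 * (4 * (Y * Z : ℝ) ^ 2)) := by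
    calc (Y * Z : ℝ) * X ^ 6 ≤ (Y * Z : ℝ) * (M ^ 5 * ∑ q ∈ T ×ˢ T, ‖∑ i ∈ range M,
        (ZMod.stdAddChar (b * (recipSum a q.1 - recipSum a q.2) *
          (c + (i : ZMod p))⁻¹) : ℂ)‖) := by
          gcongr
          exact _root_.sum_norm_pow_six_le a b c U M α hα
      _ = M ^ 5 * ∑ q ∈ T ×ˢ T, (Y * Z : ℝ) * ‖∑ i ∈ range M,
        (ZMod.stdAddChar (b * (recipSum a q.1 - recipSum a q.2) *
          (c + (i : ZMod p))⁻¹) : ℂ)‖ := by rw [← mul_sum]; ring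
      _ ≤ M ^ 5 * ∑ q ∈ T ×ˢ T, (∑ i ∈ range M, ∑ z ∈ Ioc Z (2 * Z), F (Φ (q, i, z)) +
          4 * (Y * Z : ℝ) ^ 2) := by
          gcongr with q hq
          exact norm_sum_inv_shift_le _ c M h2Z
      _ = M ^ 5 * (W + #(T ×ˢ T) * (4 * (Y * Z : ℝ) ^ 2)) := by
          rw [sum_add_distrib, sum_const, nsmul_eq_mul, hW, hΩ,
            sum_product (T ×ˢ T) (range M ×ˢ Ioc Z (2 * Z))]
          congr 2
          exact sum_congr rfl fun q _ ↦ (sum_product _ _ fun y ↦ F (Φ (q, y))).symm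
      _ ≤ _ := by
          gcongr
          exact_mod_cast hTN
  refine le_of_mul_le_mul_left (hmain.trans ?_) hYZ
  calc (M : ℝ) ^ 5 * (W + N ^ 6 * (4 * (Y * Z : ℝ) ^ 2))
      ≤ M ^ 5 * (Q * Y * (N ^ 6 * M * Z) + N ^ 6 * (4 * (Y * Z : ℝ) ^ 2)) := by gcongr
    _ = _ := by field_simp

theorem half_le_natFloor {t : ℝ} (ht : 1 ≤ t) : t / 2 ≤ ⌊t⌋₊ := by
  have h1 : (1 : ℝ) ≤ ⌊t⌋₊ := by exact_mod_cast Nat.le_floor (by simpa using ht)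
  linarith [Nat.lt_floor_add_one t]

theorem eventually_le_natCast_rpow {η : ℝ} (hη : 0 < η) (C : ℝ) :
    ∀ᶠ p : ℕ in Filter.atTop, C ≤ (p : ℝ) ^ η :=
  ((tendsto_rpow_atTop hη).comp tendsto_natCast_atTop_atTop).eventually_ge_atTop C

theorem eventually_log_add_two_le_rpow {η : ℝ} (hη : 0 < η) :
    ∀ᶠ p : ℕ in Filter.atTop, Real.log p + 2 ≤ (p : ℝ) ^ η := by
  have h := (isLittleO_log_rpow_atTop hη).bound (c := 1 / 2) (by norm_num)
  filter_upwards [tendsto_natCast_atTop_atTop.eventually h, eventually_le_natCast_rpow hη 4]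
    with p h1 h2
  rw [Real.norm_of_nonneg (by positivity : 0 ≤ (p : ℝ) ^ η)] at h1
  linarith [Real.le_norm_self (Real.log p)]

theorem eventually_divisors_harmonic_le {ε : ℝ} (hε : 0 < ε) :
    ∀ᶠ p : ℕ in Filter.atTop,
      (∀ n : ℕ, n ≠ 0 → n ≤ p ^ 3 → #n.divisors ≤ ⌊(p : ℝ) ^ (ε / 12)⌋₊) ∧
        harmonic p ≤ ⌊(p : ℝ) ^ (ε / 12)⌋₊ := by
  obtain ⟨C, hC1, hC⟩ := exists_card_divisors_le_rpow (ε / 72) (by positivity)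
  filter_upwards [eventually_le_natCast_rpow (η := ε / 24) (by positivity) C,
    eventually_log_add_two_le_rpow (η := ε / 12) (by positivity)] with p h1 h2
  constructor
  · intro n hn hnp
    apply Nat.le_floor
    calc (#n.divisors : ℝ) ≤ C * (n : ℝ) ^ (ε / 72) := hC n hn
      _ ≤ C * ((p : ℝ) ^ 3) ^ (ε / 72) := by
        gcongr
        exact_mod_cast hnp
      _ = C * (p : ℝ) ^ (ε / 24) := by
        rw [← Real.rpow_natCast_mul (by positivity)]
        congr 2
        push_cast
        ring
      _ ≤ (p : ℝ) ^ (ε / 24) * (p : ℝ) ^ (ε / 24) := by gcongr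
      _ = _ := by
        rw [← Real.rpow_add_of_nonneg (by positivity) (by positivity) (by positivity)]
        congr 1
        ring
  · have h3 : ((harmonic p : ℚ) : ℝ) ≤ ((⌊(p : ℝ) ^ (ε / 12)⌋₊ : ℚ) : ℝ) := by
      push_cast
      linarith [harmonic_le_one_add_log p, Nat.lt_floor_add_one ((p : ℝ) ^ (ε / 12))]
    exact_mod_cast h3

theorem block_length_small {p : ℕ} (hp : 0 < p) :
    10 ^ 7 * ⌊(p : ℝ) ^ ((1 : ℝ) / 18) / 3⌋₊ ^ 18 < p := by
  have h1 : (⌊(p : ℝ) ^ ((1 : ℝ) / 18) / 3⌋₊ : ℝ) ≤ (p : ℝ) ^ ((1 : ℝ) / 18) / 3 :=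
    Nat.floor_le (by positivity)
  have h2 : (10 ^ 7 * ⌊(p : ℝ) ^ ((1 : ℝ) / 18) / 3⌋₊ ^ 18 : ℝ) < p := by
    calc (10 ^ 7 * ⌊(p : ℝ) ^ ((1 : ℝ) / 18) / 3⌋₊ ^ 18 : ℝ)
        ≤ 10 ^ 7 * ((p : ℝ) ^ ((1 : ℝ) / 18) / 3) ^ 18 := by gcongr
      _ = 10 ^ 7 * (p / 3 ^ 18) := by
        rw [div_pow, ← Real.rpow_mul_natCast (by positivity)]
        norm_num
      _ < p := by
        have : (0 : ℝ) < p := by exact_mod_cast hp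
        norm_num
        linarith
  exact_mod_cast h2

/-- A choice of the free parameters in `IsBlock.sum_norm_pow_six_le`. -/
theorem eventually_exists_parameters {ε : ℝ} (hε : 0 < ε) (hε' : ε ≤ 1 / 24) {k : ℕ}
    (hk : 1 / ((k + 1 : ℕ) : ℝ) ≤ ε / 4) :
    ∀ᶠ p : ℕ in Filter.atTop, ∃ Y Z : ℕ, 0 < Y ∧ Y ≤ p ∧ 0 < Z ∧
      Z ≤ ⌊(p : ℝ) ^ (5 / 12 + ε)⌋₊ ∧ 4 * ⌊(p : ℝ) ^ (5 / 12 + ε)⌋₊ * Z < p ∧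
      846 * (⌊(p : ℝ) ^ (ε / 12)⌋₊ : ℝ) ^ 6 *
        (p * (p * ((k + 1 : ℕ) ^ (2 * (k + 1)) * (Y : ℝ) ^ (k + 1)) +
        4 * (k + 1 : ℕ) * (Y : ℝ) ^ (2 * (k + 1)))) ≤
        ((p : ℝ) ^ (-(ε / (4 * (k + 1 : ℕ))))) ^ (2 * (k + 1)) * (Y : ℝ) ^ (2 * (k + 1)) *
          (⌊(p : ℝ) ^ ((1 : ℝ) / 18) / 3⌋₊ : ℝ) ^ 3 * ⌊(p : ℝ) ^ (5 / 12 + ε)⌋₊ * Z ∧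
      (p : ℝ) ^ (-(ε / (4 * (k + 1 : ℕ)))) + 4 * (Y * Z) / ⌊(p : ℝ) ^ (5 / 12 + ε)⌋₊ ≤
        (p : ℝ) ^ (-(ε / (8 * (k + 1 : ℕ)))) := by
  set K := k + 1 with hK
  have hK1 : (1 : ℝ) ≤ K := by rw [hK]; push_cast; linarith [(Nat.cast_nonneg k : (0 : ℝ) ≤ k)]
  have hK0 : (0 : ℝ) < K := by linarith
  filter_upwards [Filter.eventually_ge_atTop 1,
    eventually_le_natCast_rpow (η := 1 / 18) (by norm_num) 3,
    eventually_le_natCast_rpow (η := 5 / 12) (by norm_num) 4,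
    eventually_le_natCast_rpow (η := 1 / 12) (by norm_num) 5,
    eventually_le_natCast_rpow (η := ε / 2) (by positivity)
      (846 * (K ^ (2 * K) + 4 * K) * 2 ^ K * 1728),
    eventually_le_natCast_rpow (η := ε / (8 * K)) (by positivity) 5]
    with p hp h18 h512 h112 hbig h5
  set x : ℝ := (p : ℝ) with hx
  have hx1 : 1 ≤ x := by rw [hx]; exact_mod_cast hp
  have hx0 : 0 < x := by linarith
  set M := ⌊x ^ (5 / 12 + ε)⌋₊ with hM
  set N := ⌊x ^ ((1 : ℝ) / 18) / 3⌋₊ with hN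
  set D := ⌊x ^ (ε / 12)⌋₊ with hD
  set Y := ⌊x ^ (1 / (K : ℝ))⌋₊ with hYdef
  set Z := ⌊M * x ^ (-(ε / 4)) / Y⌋₊ with hZdef
  have hDle : (D : ℝ) ≤ x ^ (ε / 12) := Nat.floor_le (by positivity)
  have hMle : (M : ℝ) ≤ x ^ (5 / 12 + ε) := Nat.floor_le (by positivity)
  have hYle : (Y : ℝ) ≤ x ^ (1 / (K : ℝ)) := Nat.floor_le (by positivity)
  have hMge : x ^ (5 / 12 + ε) / 2 ≤ M := half_le_natFloor (Real.one_le_rpow hx1 (by positivity))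
  have hYge : x ^ (1 / (K : ℝ)) / 2 ≤ Y := half_le_natFloor (Real.one_le_rpow hx1 (by positivity))
  have hNge : x ^ ((1 : ℝ) / 18) / 3 / 2 ≤ N := half_le_natFloor (by linarith)
  have hY0 : (0 : ℝ) < Y := lt_of_lt_of_le (by positivity) hYge
  have hM0 : (0 : ℝ) < M := lt_of_lt_of_le (by positivity) hMge
  have hY1 : 1 ≤ Y := by exact_mod_cast hY0
  have hYε : (Y : ℝ) ≤ x ^ (ε / 4) := hYle.trans (Real.rpow_le_rpow_of_exponent_le hx1 hk)
  have hYK : (Y : ℝ) ^ K ≤ x := by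
    calc (Y : ℝ) ^ K ≤ (x ^ (1 / (K : ℝ))) ^ K := by gcongr
      _ = x := by
        rw [← Real.rpow_mul_natCast hx0.le, one_div_mul_cancel hK0.ne', Real.rpow_one]
  have hYKge : x / 2 ^ K ≤ (Y : ℝ) ^ K := by
    calc x / 2 ^ K = (x ^ (1 / (K : ℝ)) / 2) ^ K := by
          rw [div_pow, ← Real.rpow_mul_natCast hx0.le, one_div_mul_cancel hK0.ne', Real.rpow_one]
      _ ≤ _ := by gcongr
  have hYp : Y ≤ p := by
    have : (Y : ℝ) ≤ (p : ℝ) := (le_self_pow₀ (by exact_mod_cast hY1) (by omega)).trans hYK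
    exact_mod_cast this
  have hquot : x ^ (5 / 12 + ε / 2) / 2 ≤ M * x ^ (-(ε / 4)) / Y := by
    rw [le_div_iff₀ hY0]
    calc x ^ (5 / 12 + ε / 2) / 2 * Y ≤ x ^ (5 / 12 + ε / 2) / 2 * x ^ (ε / 4) := by gcongr
      _ = x ^ (5 / 12 + ε) / 2 * x ^ (-(ε / 4)) := by
        rw [div_mul_eq_mul_div, div_mul_eq_mul_div, ← Real.rpow_add hx0, ← Real.rpow_add hx0]
        congr 2
        ring
      _ ≤ _ := by gcongr
  have hlarge : 4 ≤ x ^ (5 / 12 + ε / 2) :=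
    h512.trans (Real.rpow_le_rpow_of_exponent_le hx1 (by linarith))
  have hZge : x ^ (5 / 12 + ε / 2) / 4 ≤ Z := by
    have := half_le_natFloor (t := M * x ^ (-(ε / 4)) / Y) (by linarith)
    linarith
  have hZle : (Z : ℝ) ≤ M * x ^ (-(ε / 4)) / Y := Nat.floor_le (by positivity)
  have hYZ : (Y * Z : ℝ) ≤ M * x ^ (-(ε / 4)) := by
    rw [le_div_iff₀ hY0] at hZle
    linarith
  have hZ0 : 0 < Z := by
    have : (0 : ℝ) < Z := lt_of_lt_of_le (by positivity) hZge
    exact_mod_cast this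
  have hZM' : (Z : ℝ) ≤ M := by
    calc (Z : ℝ) ≤ Y * Z := le_mul_of_one_le_left (by positivity) (by exact_mod_cast hY1)
      _ ≤ M * x ^ (-(ε / 4)) := hYZ
      _ ≤ M * 1 := by
        gcongr
        exact Real.rpow_le_one_of_one_le_of_nonpos hx1 (by linarith)
      _ = M := mul_one _
  refine ⟨Y, Z, hY1, hYp, hZ0, by exact_mod_cast hZM', ?_, ?_, ?_⟩
  · have h1 : (4 * M * Z : ℝ) < p := by
      calc (4 * M * Z : ℝ) ≤ 4 * M * M := by gcongr
        _ ≤ 4 * x ^ (5 / 12 + ε) * x ^ (5 / 12 + ε) := by gcongr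
        _ = 4 * x ^ (5 / 6 + 2 * ε) := by
          rw [mul_assoc, ← Real.rpow_add hx0]
          congr 2
          ring
        _ ≤ 4 * x ^ ((11 : ℝ) / 12) := by
          gcongr
          linarith
        _ < x ^ ((1 : ℝ) / 12) * x ^ ((11 : ℝ) / 12) := by
          gcongr
          linarith
        _ = p := by
          rw [← Real.rpow_add hx0]
          norm_num [hx]
    exact_mod_cast h1
  · have hQ : (x ^ (-(ε / (4 * (K : ℝ))))) ^ (2 * K) = x ^ (-(ε / 2)) := by
      rw [← Real.rpow_mul_natCast hx0.le]
      congr 1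
      push_cast
      field_simp
      ring
    have hN3 : x ^ ((1 : ℝ) / 6) / 216 ≤ (N : ℝ) ^ 3 := by
      calc x ^ ((1 : ℝ) / 6) / 216 = (x ^ ((1 : ℝ) / 18) / 3 / 2) ^ 3 := by
            rw [div_div, div_pow, ← Real.rpow_mul_natCast hx0.le]
            norm_num
        _ ≤ _ := by gcongr
    have hD6 : (D : ℝ) ^ 6 ≤ x ^ (ε / 2) := by
      calc (D : ℝ) ^ 6 ≤ (x ^ (ε / 12)) ^ 6 := by gcongr
        _ = _ := by
          rw [← Real.rpow_mul_natCast hx0.le]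
          congr 1
          push_cast
          ring
    have hpow : x ^ (ε / 2) * x ^ (ε / 2) * x ^ 2 =
        x ^ (-(ε / 2)) * x * x ^ ((1 : ℝ) / 6) * x ^ (5 / 12 + ε) * x ^ (5 / 12 + ε / 2) := by
      calc x ^ (ε / 2) * x ^ (ε / 2) * x ^ 2 = x ^ (ε / 2 + ε / 2 + 2) := by
            rw [Real.rpow_add hx0, Real.rpow_add hx0, Real.rpow_two]
        _ = x ^ (-(ε / 2) + 1 + 1 / 6 + (5 / 12 + ε) + (5 / 12 + ε / 2)) := by
            congr 1
            ring
        _ = _ := by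
            rw [Real.rpow_add hx0 (-(ε / 2) + 1 + 1 / 6 + (5 / 12 + ε)),
              Real.rpow_add hx0 (-(ε / 2) + 1 + 1 / 6), Real.rpow_add hx0 (-(ε / 2) + 1),
              Real.rpow_add hx0 (-(ε / 2)), Real.rpow_one]
    rw [hQ]
    calc 846 * (D : ℝ) ^ 6 * (x * (x * ((K : ℝ) ^ (2 * K) * (Y : ℝ) ^ K) +
          4 * (K : ℝ) * (Y : ℝ) ^ (2 * K)))
        = 846 * (D : ℝ) ^ 6 * (x * (x * ((K : ℝ) ^ (2 * K) * (Y : ℝ) ^ K) +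
          4 * (K : ℝ) * ((Y : ℝ) ^ K * (Y : ℝ) ^ K))) := by rw [two_mul K, pow_add (Y : ℝ) K K]
      _ ≤ 846 * x ^ (ε / 2) * (x * (x * ((K : ℝ) ^ (2 * K) * (Y : ℝ) ^ K) +
          4 * (K : ℝ) * (x * (Y : ℝ) ^ K))) := by gcongr
      _ = (846 * (K ^ (2 * K) + 4 * K) * 2 ^ K * 1728) *
          (x ^ (ε / 2) * x ^ 2 * (Y : ℝ) ^ K / (2 ^ K * 1728)) := by
          field_simp
      _ ≤ x ^ (ε / 2) * (x ^ (ε / 2) * x ^ 2 * (Y : ℝ) ^ K / (2 ^ K * 1728)) := by gcongr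
      _ = (x ^ (ε / 2) * x ^ (ε / 2) * x ^ 2) * ((Y : ℝ) ^ K / (2 ^ K * 1728)) := by ring
      _ = x ^ (-(ε / 2)) * (x / 2 ^ K * (Y : ℝ) ^ K) * (x ^ ((1 : ℝ) / 6) / 216) *
          (x ^ (5 / 12 + ε) / 2) * (x ^ (5 / 12 + ε / 2) / 4) := by
          rw [hpow]
          field_simp
          norm_num
      _ ≤ x ^ (-(ε / 2)) * ((Y : ℝ) ^ K * (Y : ℝ) ^ K) * (N : ℝ) ^ 3 * M * Z := by gcongr
      _ = _ := by rw [two_mul K, pow_add (Y : ℝ) K K]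
  · have e1 : x ^ (-(ε / 4)) ≤ x ^ (-(ε / (4 * (K : ℝ)))) := by
      apply Real.rpow_le_rpow_of_exponent_le hx1
      gcongr
      linarith
    have e2 : (4 * (Y * Z) / M : ℝ) ≤ 4 * x ^ (-(ε / 4)) := by
      rw [div_le_iff₀ hM0]
      linarith
    calc x ^ (-(ε / (4 * (K : ℝ)))) + 4 * (Y * Z) / M
        ≤ 5 * x ^ (-(ε / (4 * (K : ℝ)))) := by linarith
      _ ≤ x ^ (ε / (8 * (K : ℝ))) * x ^ (-(ε / (4 * (K : ℝ)))) := by gcongr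
      _ = _ := by
        rw [← Real.rpow_add hx0]
        congr 1
        field_simp
        norm_num

/-- Power saving for bilinear sums over one block. -/
theorem exists_block_saving {ε : ℝ} (hε : 0 < ε) (hε' : ε ≤ 1 / 24) :
    ∃ δ : ℝ, 0 < δ ∧ ∀ᶠ p : ℕ in Filter.atTop, ∀ [Fact p.Prime] (a b c : ZMod p) (U : Finset ℕ)
      (α : ℕ → ℂ), b ≠ 0 → IsBlock p a ⌊(p : ℝ) ^ ((1 : ℝ) / 18) / 3⌋₊ U →
      (∀ u ∈ U, ‖α u‖ ≤ 1) →
      ∑ i ∈ range ⌊(p : ℝ) ^ (5 / 12 + ε)⌋₊, ‖∑ u ∈ U, α u *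
        (ZMod.stdAddChar (b * (a + (u : ZMod p))⁻¹ * (c + (i : ZMod p))⁻¹) : ℂ)‖ ≤
        (p : ℝ) ^ (-δ) * (⌊(p : ℝ) ^ (5 / 12 + ε)⌋₊ * ⌊(p : ℝ) ^ ((1 : ℝ) / 18) / 3⌋₊) := by
  obtain ⟨k, hk⟩ := exists_nat_one_div_lt (show 0 < ε / 4 by positivity)
  refine ⟨ε / (8 * (k + 1 : ℕ)) / 6, by positivity, ?_⟩
  filter_upwards [eventually_exists_parameters (k := k) hε hε' (by exact_mod_cast hk.le),
    eventually_divisors_harmonic_le hε, Filter.eventually_ge_atTop 1] with p hpar hdiv hp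
  intro _ a b c U α hb hU hα
  obtain ⟨Y, Z, hY, hYp, hZ, hZM, hMZ, hQk, hfin⟩ := hpar
  have h := hU.sum_norm_pow_six_le hb c hdiv.1 hdiv.2 hY hYp hZ hZM hMZ (by positivity) hQk α hα
  refine le_of_pow_le_pow_left₀ (n := 6) (by norm_num) (by positivity) (h.trans ?_)
  rw [mul_pow ((p : ℝ) ^ _), ← Real.rpow_mul_natCast (by positivity), mul_comm]
  gcongr
  refine hfin.trans_eq ?_
  congr 1
  push_cast
  ring

theorem ep_eq_stdAddChar {p : ℕ} [NeZero p] (z : ZMod p) :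
    ep p z = (ZMod.stdAddChar z : ℂ) := by
  rw [ZMod.stdAddChar_apply, ZMod.toCircle_apply, ep]

section Interval

variable {p : ℕ} [Fact p.Prime] {a : ZMod p} {n : ℕ}

theorem interval_length_lt (h : (0 : ZMod p) ∉ interval p a n) : n < p := by
  by_contra! hn
  apply h
  rw [interval, mem_image]
  have hp := (Fact.out : p.Prime).pos
  rcases eq_or_ne a 0 with rfl | ha
  · exact ⟨p, mem_Icc.2 ⟨hp, hn⟩, by simp⟩
  · refine ⟨(-a).val, mem_Icc.2 ⟨?_, ((ZMod.val_lt _).trans_le hn).le⟩, by simp⟩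
    rw [Nat.one_le_iff_ne_zero, Ne, ZMod.val_eq_zero, neg_eq_zero]
    exact ha

theorem interval_eq_image_range (p : ℕ) (a : ZMod p) (n : ℕ) :
    interval p a n = (range n).image fun i : ℕ ↦ a + 1 + (i : ZMod p) := by
  ext x
  simp only [interval, mem_image, mem_Icc, mem_range]
  constructor
  · rintro ⟨i, hi, rfl⟩
    obtain ⟨j, rfl⟩ := Nat.exists_eq_add_of_le hi.1
    exact ⟨j, by omega, by push_cast; ring⟩
  · rintro ⟨i, hi, rfl⟩
    exact ⟨1 + i, by omega, by push_cast; ring⟩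

theorem injOn_interval (h : (0 : ZMod p) ∉ interval p a n) :
    Set.InjOn (fun i : ℕ ↦ a + 1 + (i : ZMod p)) (range n) := by
  have hn := interval_length_lt h
  intro i hi j hj hij
  rw [mem_coe, mem_range] at hi hj
  have := congr_arg ZMod.val (add_left_cancel hij)
  rwa [ZMod.val_natCast_of_lt (by omega), ZMod.val_natCast_of_lt (by omega)] at this

theorem card_interval (h : (0 : ZMod p) ∉ interval p a n) : #(interval p a n) = n := by
  rw [interval_eq_image_range, card_image_of_injOn (injOn_interval h), card_range]

theorem sum_interval (h : (0 : ZMod p) ∉ interval p a n) (f : ZMod p → ℂ) :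
    ∑ x ∈ interval p a n, f x = ∑ i ∈ range n, f (a + 1 + (i : ZMod p)) := by
  rw [interval_eq_image_range, sum_image (injOn_interval h)]

theorem mem_interval_of_lt {i : ℕ} (hi : i < n) : a + 1 + (i : ZMod p) ∈ interval p a n := by
  rw [interval_eq_image_range]
  exact mem_image_of_mem _ (mem_range.2 hi)

end Interval

theorem sum_range_mul_eq {E : Type*} [AddCommMonoid E] (g : ℕ → E) (J L : ℕ) :
    ∑ i ∈ range (J * L), g i = ∑ j ∈ range J, ∑ u ∈ range L, g (j * L + u) := by
  induction J with
  | zero => simp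
  | succ J ih => rw [add_mul, one_mul, sum_range_add, ih, sum_range_succ]

theorem sum_range_eq_sum_blocks {E : Type*} [AddCommMonoid E] (g : ℕ → E) (n : ℕ) {L : ℕ}
    (hL : 0 < L) :
    ∑ i ∈ range n, g i =
      ∑ j ∈ range (n / L + 1), ∑ u ∈ range L with j * L + u < n, g (j * L + u) := by
  have hn : n ≤ (n / L + 1) * L := by
    have := Nat.div_add_mod n L
    have := Nat.mod_lt n hL
    rw [add_mul, one_mul, mul_comm]
    omega
  have h := sum_range_mul_eq (fun i ↦ if i < n then g i else 0) (n / L + 1) L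
  simp_rw [sum_filter]
  rw [← h, ← sum_filter]
  congr 1
  ext i
  simp only [mem_range, mem_filter]
  omega

theorem sum_range_le_sum_blocks (g : ℕ → ℝ) (hg : ∀ i, 0 ≤ g i) (n : ℕ) {L : ℕ} (hL : 0 < L) :
    ∑ i ∈ range n, g i ≤ ∑ j ∈ range (n / L + 1), ∑ u ∈ range L, g (j * L + u) := by
  rw [sum_range_eq_sum_blocks g n hL]
  refine sum_le_sum fun j _ ↦ ?_
  exact sum_le_sum_of_subset_of_nonneg (filter_subset _ _) fun _ _ _ ↦ hg _

theorem div_add_one_mul_le {n L : ℕ} (h : L ≤ n) : (n / L + 1) * L ≤ 2 * n := by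
  have := Nat.div_mul_le_self n L
  rw [add_mul, one_mul]
  omega

theorem add_ne_zero_of_val_lt {p : ℕ} [NeZero p] {x y : ZMod p} (hx0 : x ≠ 0)
    (hx : 2 * x.val < p) (hy : 2 * y.val < p) : x + y ≠ 0 := by
  intro h
  have h1 := congr_arg ZMod.val h
  rw [ZMod.val_add_of_lt (by omega), ZMod.val_zero] at h1
  exact hx0 ((ZMod.val_eq_zero x).1 (by omega))

theorem add_ne_zero_of_lt_val {p : ℕ} [NeZero p] {x y : ZMod p}
    (hx : p < 2 * x.val) (hy : p < 2 * y.val) : x + y ≠ 0 := by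
  intro h
  have h1 := ZMod.val_add_of_le (show p ≤ x.val + y.val by omega)
  rw [h, ZMod.val_zero] at h1
  omega

theorem norm_bilinear_interval_le {p : ℕ} [Fact p.Prime] (hp2 : 2 < p) {a₁ a₂ b : ZMod p}
    {N M n₁ n₂ : ℕ} (hN0 : 0 < N) (hM0 : 0 < M) (hN : N ≤ n₁) (hM : M ≤ n₂)
    (hsmall : 10 ^ 7 * N ^ 18 < p) (h₁ : (0 : ZMod p) ∉ interval p a₁ n₁)
    (h₂ : (0 : ZMod p) ∉ interval p a₂ n₂) {α₁ α₂ : ZMod p → ℂ}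
    (hα₁ : ∀ x ∈ interval p a₁ n₁, ‖α₁ x‖ ≤ 1) (hα₂ : ∀ x ∈ interval p a₂ n₂, ‖α₂ x‖ ≤ 1)
    {B : ℝ} (hB : ∀ (a c : ZMod p) (U : Finset ℕ) (α : ℕ → ℂ), IsBlock p a N U →
      (∀ u ∈ U, ‖α u‖ ≤ 1) → ∑ i ∈ range M, ‖∑ u ∈ U, α u *
        (ZMod.stdAddChar (b * (a + (u : ZMod p))⁻¹ * (c + (i : ZMod p))⁻¹) : ℂ)‖ ≤
        B * (M * N)) :
    ‖∑ x₁ ∈ interval p a₁ n₁, ∑ x₂ ∈ interval p a₂ n₂,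
      α₁ x₁ * α₂ x₂ * ep p (b * x₁⁻¹ * x₂⁻¹)‖ ≤ 8 * B * (n₁ * n₂) := by
  let term : ℕ → ZMod p → ℂ := fun i x ↦ α₁ (a₁ + 1 + (i : ZMod p)) *
    (ZMod.stdAddChar (b * (a₁ + 1 + (i : ZMod p))⁻¹ * x⁻¹) : ℂ)
  let f : ZMod p → ℂ := fun x ↦ ∑ i ∈ range n₁, term i x
  let V : ℕ → Finset ℕ := fun j ↦ {u ∈ range N | j * N + u < n₁}
  let low : ℕ → Prop := fun i ↦ 2 * (a₁ + 1 + (i : ZMod p)).val < p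
  have hpodd : ∀ m : ℕ, 2 * m ≠ p := fun m hm ↦ by
    have := (Nat.prime_dvd_prime_iff_eq Nat.prime_two (Fact.out : p.Prime)).1 ⟨m, hm.symm⟩
    omega
  have hshift : ∀ j u : ℕ, a₁ + 1 + ((j * N + u : ℕ) : ZMod p) =
      a₁ + 1 + ((j * N : ℕ) : ZMod p) + (u : ZMod p) := fun j u ↦ by push_cast; ring
  have hne : ∀ j, ∀ u ∈ V j, a₁ + 1 + ((j * N + u : ℕ) : ZMod p) ≠ 0 := fun j u hu h0 ↦
    h₁ (h0 ▸ mem_interval_of_lt (mem_filter.1 hu).2)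
  have hlow : ∀ j, IsBlock p (a₁ + 1 + ((j * N : ℕ) : ZMod p)) N {u ∈ V j | low (j * N + u)} :=
    fun j ↦
    { lt := fun u hu ↦ mem_range.1 (mem_filter.1 (mem_filter.1 hu).1).1
      ne_zero := fun u hu ↦ hshift j u ▸ hne j u (mem_filter.1 hu).1
      add_ne_zero := fun u hu v hv ↦ by
        rw [mem_filter] at hu hv
        rw [← hshift, ← hshift]
        exact add_ne_zero_of_val_lt (hne j u hu.1) hu.2 hv.2
      small := hsmall }
  have hhigh : ∀ j, IsBlock p (a₁ + 1 + ((j * N : ℕ) : ZMod p)) N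
      {u ∈ V j | ¬ low (j * N + u)} := fun j ↦
    { lt := fun u hu ↦ mem_range.1 (mem_filter.1 (mem_filter.1 hu).1).1
      ne_zero := fun u hu ↦ hshift j u ▸ hne j u (mem_filter.1 hu).1
      add_ne_zero := fun u hu v hv ↦ by
        rw [mem_filter] at hu hv
        rw [← hshift, ← hshift]
        exact add_ne_zero_of_lt_val (lt_of_le_of_ne (not_lt.1 hu.2) (hpodd _).symm)
          (lt_of_le_of_ne (not_lt.1 hv.2) (hpodd _).symm)
      small := hsmall }
  have hblock : ∀ (c : ZMod p) (j : ℕ) (U : Finset ℕ), U ⊆ V j →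
      IsBlock p (a₁ + 1 + ((j * N : ℕ) : ZMod p)) N U →
      ∑ i ∈ range M, ‖∑ u ∈ U, term (j * N + u) (c + (i : ZMod p))‖ ≤ B * (M * N) := by
    intro c j U hUV hU
    have := hB _ c U (fun u ↦ α₁ (a₁ + 1 + ((j * N + u : ℕ) : ZMod p))) hU fun u hu ↦
      hα₁ _ (mem_interval_of_lt (mem_filter.1 (hUV hu)).2)
    simpa only [term, hshift] using this
  have hpoint : ∀ x, ‖f x‖ ≤ ∑ j ∈ range (n₁ / N + 1),
      (‖∑ u ∈ V j with low (j * N + u), term (j * N + u) x‖ +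
        ‖∑ u ∈ V j with ¬ low (j * N + u), term (j * N + u) x‖) := by
    intro x
    simp only [f]
    rw [sum_range_eq_sum_blocks (fun i ↦ term i x) n₁ hN0]
    refine norm_sum_le_of_le _ fun j _ ↦ ?_
    rw [← sum_filter_add_sum_filter_not (V j) (fun u ↦ low (j * N + u))]
    exact norm_add_le _ _
  have hlong : ∀ c : ZMod p, ∑ i ∈ range M, ‖f (c + (i : ZMod p))‖ ≤
      2 * B * M * ((n₁ / N + 1 : ℕ) * N) := by
    intro c
    calc ∑ i ∈ range M, ‖f (c + (i : ZMod p))‖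
        ≤ ∑ i ∈ range M, ∑ j ∈ range (n₁ / N + 1),
          (‖∑ u ∈ V j with low (j * N + u), term (j * N + u) (c + (i : ZMod p))‖ +
          ‖∑ u ∈ V j with ¬ low (j * N + u), term (j * N + u) (c + (i : ZMod p))‖) :=
          sum_le_sum fun i _ ↦ hpoint _
      _ ≤ ∑ j ∈ range (n₁ / N + 1), (B * (M * N) + B * (M * N)) := by
          rw [sum_comm]
          refine sum_le_sum fun j _ ↦ ?_
          rw [sum_add_distrib]
          exact add_le_add (hblock c j _ (filter_subset _ _) (hlow j))
            (hblock c j _ (filter_subset _ _) (hhigh j))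
      _ = _ := by
          rw [sum_const, card_range, nsmul_eq_mul]
          ring
  have hB0 : 0 ≤ B := by
    have h := (sum_nonneg fun _ _ ↦ norm_nonneg _).trans
      (hblock 0 0 _ (filter_subset _ _) (hlow 0))
    exact nonneg_of_mul_nonneg_left h (by positivity)
  have hN' : (((n₁ / N + 1 : ℕ) : ℝ) * N) ≤ 2 * n₁ := by exact_mod_cast div_add_one_mul_le hN
  have hM' : (((n₂ / M + 1 : ℕ) : ℝ) * M) ≤ 2 * n₂ := by exact_mod_cast div_add_one_mul_le hM
  calc _ = ‖∑ i ∈ range n₂, α₂ (a₂ + 1 + (i : ZMod p)) * f (a₂ + 1 + (i : ZMod p))‖ := by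
        rw [sum_comm, sum_interval h₂]
        congr 1
        refine sum_congr rfl fun i _ ↦ ?_
        rw [sum_interval h₁, mul_sum]
        refine sum_congr rfl fun j _ ↦ ?_
        rw [ep_eq_stdAddChar]
        ring
    _ ≤ ∑ i ∈ range n₂, ‖f (a₂ + 1 + (i : ZMod p))‖ := by
        refine norm_sum_le_of_le _ fun i hi ↦ ?_
        rw [norm_mul]
        exact mul_le_of_le_one_left (norm_nonneg _)
          (hα₂ _ (mem_interval_of_lt (mem_range.1 hi)))
    _ ≤ ∑ l ∈ range (n₂ / M + 1), ∑ i ∈ range M, ‖f (a₂ + 1 + ((l * M + i : ℕ) : ZMod p))‖ :=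
        sum_range_le_sum_blocks (fun i ↦ ‖f (a₂ + 1 + (i : ZMod p))‖) (fun _ ↦ norm_nonneg _) n₂ hM0
    _ ≤ ∑ l ∈ range (n₂ / M + 1), 2 * B * M * ((n₁ / N + 1 : ℕ) * N) := by
        refine sum_le_sum fun l _ ↦ ?_
        refine le_of_eq_of_le (sum_congr rfl fun i _ ↦ ?_)
          (hlong (a₂ + 1 + ((l * M : ℕ) : ZMod p)))
        push_cast
        rw [add_assoc (a₂ + 1)]
    _ = 2 * B * (((n₂ / M + 1 : ℕ) : ℝ) * M) * (((n₁ / N + 1 : ℕ) : ℝ) * N) := by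
        rw [sum_const, card_range, nsmul_eq_mul]
        ring
    _ ≤ 2 * B * (2 * n₂) * (2 * n₁) := by gcongr
    _ = _ := by ring

/-- for every `ε > 0` there are `δ > 0` and `p_0` such that for every prime
`p ≥ p_0`, all intervals `I_1, I_2 ⊂ F_p` not containing `0` with `|I_1| > p^{1/18}` and
`|I_2| > p^{5/12+ε}`, all `1`-bounded coefficients and every `a ≠ 0`, one has
`|∑_{x_1∈I_1} ∑_{x_2∈I_2} α_1(x_1)α_2(x_2) e_p(a x_1⁻¹ x_2⁻¹)| < p^{−δ}|I_1||I_2|`. -/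
theorem stmt_7 (ε : ℝ) (hε : 0 < ε) :
    ∃ δ : ℝ, 0 < δ ∧ ∃ p0 : ℕ, ∀ p : ℕ, p.Prime → p0 ≤ p →
      ∀ (a1 a2 : ZMod p) (N1 N2 : ℕ),
        (0 : ZMod p) ∉ interval p a1 N1 →
        (0 : ZMod p) ∉ interval p a2 N2 →
        (p : ℝ) ^ ((1 : ℝ) / 18) < ((interval p a1 N1).card : ℝ) →
        (p : ℝ) ^ ((5 : ℝ) / 12 + ε) < ((interval p a2 N2).card : ℝ) →
        ∀ α1 α2 : ZMod p → ℂ,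
          (∀ x ∈ interval p a1 N1, ‖α1 x‖ ≤ 1) →
          (∀ x ∈ interval p a2 N2, ‖α2 x‖ ≤ 1) →
          ∀ b : ZMod p, b ≠ 0 →
            ‖∑ x1 ∈ interval p a1 N1, ∑ x2 ∈ interval p a2 N2,
                α1 x1 * α2 x2 * ep p (b * x1⁻¹ * x2⁻¹)‖ <
              (p : ℝ) ^ (-δ) * ((interval p a1 N1).card : ℝ) *
                ((interval p a2 N2).card : ℝ) := by
  obtain ⟨δ, hδ, hδp⟩ := exists_block_saving (ε := min ε (1 / 24)) (by positivity) (min_le_right _ _)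
  set ε' := min ε (1 / 24) with hε'
  have hε'0 : 0 < ε' := by positivity
  obtain ⟨p0, hp0⟩ := Filter.eventually_atTop.1 (((hδp.and (eventually_le_natCast_rpow
    (η := 1 / 18) (by norm_num) 3)).and (Filter.eventually_gt_atTop 2)).and
    (eventually_le_natCast_rpow (η := δ / 2) (by positivity) 9))
  refine ⟨δ / 2, by positivity, p0, ?_⟩
  intro p hp hpp a1 a2 N1 N2 h1 h2 hc1 hc2 α1 α2 hα1 hα2 b hb
  have : Fact p.Prime := ⟨hp⟩
  obtain ⟨⟨⟨hblock, h18⟩, hp2⟩, h9⟩ := hp0 p hpp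
  have hpR : (1 : ℝ) < p := by exact_mod_cast hp.one_lt
  rw [card_interval h1] at hc1 ⊢
  rw [card_interval h2] at hc2 ⊢
  have hN1 : ⌊(p : ℝ) ^ ((1 : ℝ) / 18) / 3⌋₊ ≤ N1 := by
    apply Nat.floor_le_of_le
    linarith
  have hM2 : ⌊(p : ℝ) ^ (5 / 12 + ε')⌋₊ ≤ N2 := by
    apply Nat.floor_le_of_le
    refine le_trans ?_ hc2.le
    gcongr
    · exact hpR.le
    · exact min_le_left _ _
  have hbound := norm_bilinear_interval_le (b := b) hp2
    (Nat.floor_pos.2 (by linarith)) (Nat.floor_pos.2 (Real.one_le_rpow hpR.le (by positivity)))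
    hN1 hM2 (block_length_small hp.pos) h1 h2 hα1 hα2
    fun a c U α hU hα ↦ hblock a b c U α hb hU hα
  refine hbound.trans_lt ?_
  have hN1' : (0 : ℝ) < N1 := lt_trans (by positivity) hc1
  have hN2' : (0 : ℝ) < N2 := lt_trans (by positivity) hc2
  rw [mul_assoc ((p : ℝ) ^ (-(δ / 2)))]
  gcongr
  calc 8 * (p : ℝ) ^ (-δ) < (p : ℝ) ^ (δ / 2) * (p : ℝ) ^ (-δ) := by
        gcongr
        linarith
    _ = _ := by
        rw [← Real.rpow_add (by linarith)]
        congr 1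
        ring
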